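/- arXiv:1904.07196 — 2 statements merged into one kernel-verified Lean document; each statement's English description precedes it below -/
import Mathlib

section
/- Let I be a nonempty open real interval, let n ≥ 3, let f, g: I → ℝ be three times differentiable on I with nonvanishing first derivatives, let p = (p_1,…,p_n): I → ℝ_+^n be continuous on I, and let q = (q_1,…,q_n): I → ℝ_+^n. Assume there exist pairwise distinct i, j, k ∈ {1,…,n} such that p_i, p_j, p_k are differentiable on I. Then the following are equivalent: (i) A_{f,p} = A_{g,q} on I^n; (ii) there is an open subset U of I^n containing the diagonal diag(I^n) such that A_{f,p} = A_{g,q} on U; (iv) there exist a, b, c, d ∈ ℝ with ad ≠ bc such that g = (af + b)/(cf + d) on I and q_ℓ = (cf + d)·p_ℓ on I for every ℓ ∈ {1,…,n}. -/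
/-- The `n`-variable generalized Bajraktarević mean built from `f`, its
generalized left inverse `finv`, and the weight functions `p`. -/
noncomputable def bmean {n : ℕ} (f finv : ℝ → ℝ) (p : Fin n → ℝ → ℝ)
    (x : Fin n → ℝ) : ℝ :=
  finv ((∑ i, p i (x i) * f (x i)) / ∑ i, p i (x i))

open Set Filter Topology

/-- A locally additive function that is nonnegative on the right of `0` is linear near `0`. -/
theorem exists_linear_of_additive_of_nonneg {H : ℝ → ℝ} {ε : ℝ} (hε : 0 < ε)
    (hadd : ∀ v w, |v| < ε → |w| < ε → |v + w| < ε → H (v + w) = H v + H w)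
    (hnn : ∀ v, 0 ≤ v → v < ε → 0 ≤ H v) :
    ∃ c, ∀ v, |v| < ε / 2 → H v = c * v := by
  obtain ⟨e, he, he0⟩ : ∃ e, e = ε / 2 ∧ 0 < e := ⟨ε / 2, rfl, by positivity⟩
  have hadd' : ∀ v w, -ε < v → v < ε → -ε < w → w < ε → -ε < v + w → v + w < ε →
      H (v + w) = H v + H w := fun v w h1 h2 h3 h4 h5 h6 =>
    hadd v w (abs_lt.2 ⟨h1, h2⟩) (abs_lt.2 ⟨h3, h4⟩) (abs_lt.2 ⟨h5, h6⟩)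
  have h0 : H 0 = 0 := by
    have := hadd' 0 0 (by linarith) hε (by linarith) hε (by linarith) (by linarith)
    rw [add_zero] at this
    linarith
  have hce : H e / e * e = H e := by field_simp
  set c := H e / e with hc
  have hc0 : 0 ≤ c := div_nonneg (hnn e he0.le (by linarith)) he0.le
  have bound : ∀ m : ℕ, ∀ v, 0 ≤ v → v ≤ e → |H v - c * v| ≤ H e / 2 ^ m := by
    intro m
    induction m with
    | zero =>
      intro v hv hve
      have h1 := hnn v hv (by linarith)
      have h2 := hnn (e - v) (by linarith) (by linarith)
      have h3 := hadd' v (e - v) (by linarith) (by linarith) (by linarith) (by linarith)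
        (by linarith) (by linarith)
      rw [add_sub_cancel] at h3
      have h4 : 0 ≤ c * v := mul_nonneg hc0 hv
      have h5 : c * v ≤ c * e := mul_le_mul_of_nonneg_left hve hc0
      rw [abs_le, pow_zero, div_one]
      constructor <;> linarith
    | succ m ih =>
      intro v hv hve
      rw [pow_succ, ← div_div]
      rcases le_total (2 * v) e with h | h
      · have h1 := ih (2 * v) (by linarith) h
        have h3 := hadd' v v (by linarith) (by linarith) (by linarith) (by linarith)
          (by linarith) (by linarith)
        rw [← two_mul] at h3
        rw [h3, abs_le] at h1
        rw [abs_le]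
        constructor <;> linarith
      · have h1 := ih (2 * v - e) (by linarith) (by linarith)
        have h3 := hadd' v (v - e) (by linarith) (by linarith) (by linarith) (by linarith)
          (by linarith) (by linarith)
        have h4 := hadd' (v - e) e (by linarith) (by linarith) (by linarith) (by linarith)
          (by linarith) (by linarith)
        rw [sub_add_cancel] at h4
        rw [show v + (v - e) = 2 * v - e by ring] at h3
        rw [h3, abs_le] at h1
        rw [abs_le]
        constructor <;> linarith
  have hpos : ∀ v, 0 ≤ v → v ≤ e → H v = c * v := by
    intro v hv hve
    have hlim : Tendsto (fun m : ℕ => H e / 2 ^ m) atTop (𝓝 0) :=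
      tendsto_const_nhds.div_atTop (tendsto_pow_atTop_atTop_of_one_lt one_lt_two)
    have h1 := ge_of_tendsto' hlim fun m => bound m v hv hve
    exact sub_eq_zero.1 (abs_nonpos_iff.1 h1)
  refine ⟨c, fun v hv => ?_⟩
  obtain ⟨hv1, hv2⟩ := abs_lt.1 hv
  rcases le_total 0 v with h | h
  · exact hpos v h (by linarith)
  · have h1 := hpos (-v) (by linarith) (by linarith)
    have h2 := hadd' v (-v) (by linarith) (by linarith) (by linarith) (by linarith)
      (by linarith) (by linarith)
    rw [add_neg_cancel, h0, h1] at h2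
    linarith

/-- If three real functions attain all small values and the vanishing of their sum forces the
vanishing of a second sum, then the second functions are proportional to the first ones. -/
theorem exists_proportional_of_sum_eq_zero {α : Type*} {V : Set α} {w₁ w₂ w₃ u₁ u₂ u₃ : α → ℝ}
    {y : α} (hy : y ∈ V) (hw₁ : w₁ y = 0) (hw₂ : w₂ y = 0) (hu₁ : u₁ y = 0)
    (hu₂ : u₂ y = 0) {ε : ℝ} (hε : 0 < ε)
    (h₁ : ∀ v, |v| < ε → ∃ t ∈ V, w₁ t = v) (h₂ : ∀ v, |v| < ε → ∃ t ∈ V, w₂ t = v)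
    (h₃ : ∀ v, |v| < ε → ∃ t ∈ V, w₃ t = v)
    (hsum : ∀ r ∈ V, ∀ s ∈ V, ∀ t ∈ V, w₁ r + w₂ s + w₃ t = 0 → u₁ r + u₂ s + u₃ t = 0)
    (hnn : ∀ t ∈ V, 0 ≤ w₁ t → 0 ≤ u₁ t) :
    ∃ c, ∀ t ∈ V, (|w₁ t| < ε / 2 → u₁ t = c * w₁ t) ∧ (|w₂ t| < ε / 2 → u₂ t = c * w₂ t) := by
  have : Nonempty α := ⟨y⟩
  choose! τ₁ hτ₁V hτ₁ using h₁
  choose! τ₂ hτ₂V hτ₂ using h₂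
  choose! τ₃ hτ₃V hτ₃ using h₃
  set H : ℝ → ℝ := fun v => -u₃ (τ₃ (-v)) with hH
  have key₁ : ∀ t ∈ V, |w₁ t| < ε → u₁ t = H (w₁ t) := by
    intro t ht hlt
    rw [← abs_neg] at hlt
    have := hsum t ht y hy _ (hτ₃V _ hlt) (by rw [hτ₃ _ hlt, hw₂]; ring)
    simp only [hH]
    linarith
  have key₂ : ∀ t ∈ V, |w₂ t| < ε → u₂ t = H (w₂ t) := by
    intro t ht hlt
    rw [← abs_neg] at hlt
    have := hsum y hy t ht _ (hτ₃V _ hlt) (by rw [hτ₃ _ hlt, hw₁]; ring)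
    simp only [hH]
    linarith
  obtain ⟨c, hc⟩ := exists_linear_of_additive_of_nonneg (H := H) hε
    (by
      intro v w hv hw hvw
      have e1 := key₁ _ (hτ₁V v hv) (by rwa [hτ₁ v hv])
      have e2 := key₂ _ (hτ₂V w hw) (by rwa [hτ₂ w hw])
      rw [hτ₁ v hv] at e1
      rw [hτ₂ w hw] at e2
      rw [← abs_neg] at hvw
      have := hsum _ (hτ₁V v hv) _ (hτ₂V w hw) _ (hτ₃V _ hvw)
        (by rw [hτ₁ v hv, hτ₂ w hw, hτ₃ _ hvw]; ring)
      have e3 : H (v + w) = -u₃ (τ₃ (-(v + w))) := rfl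
      linarith)
    (by
      intro v hv hlt
      have hv' : |v| < ε := by rwa [abs_of_nonneg hv]
      have e1 := key₁ _ (hτ₁V v hv') (by rwa [hτ₁ v hv'])
      rw [hτ₁ v hv'] at e1
      rw [← e1]
      exact hnn _ (hτ₁V v hv') (by rwa [hτ₁ v hv']))
  refine ⟨c, fun t ht => ⟨fun h => ?_, fun h => ?_⟩⟩
  · rw [key₁ t ht (by linarith), hc _ h]
  · rw [key₂ t ht (by linarith), hc _ h]

/-- A sum whose terms vanish at a base point, evaluated at a point that differs from the base
point in three coordinates. -/
theorem sum_ite_three {ι M : Type*} [Fintype ι] [DecidableEq ι] [AddCommMonoid M] {α : Type*}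
    (F : ι → α → M) {y : α} (hF : ∀ m, F m y = 0) {a b c : ι} (hab : a ≠ b) (hbc : b ≠ c)
    (hac : a ≠ c) (r s t : α) :
    ∑ m, F m (if m = a then r else if m = b then s else if m = c then t else y) =
      F a r + F b s + F c t := by
  have : ∀ m, F m (if m = a then r else if m = b then s else if m = c then t else y) =
      (if m = a then F a r else 0) + (if m = b then F b s else 0) +
        (if m = c then F c t else 0) := by
    intro m
    by_cases h1 : m = a
    · subst h1; simp [hab, hac]
    · by_cases h2 : m = b
      · subst h2; simp [hbc, h1]
      · by_cases h3 : m = c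
        · subst h3; simp [h1, h2]
        · simp [h1, h2, h3, hF]
  simp only [this, Finset.sum_add_distrib, Finset.sum_ite_eq', Finset.mem_univ, if_true]

/-- Local affinity with respect to an injective function on a connected open set is global. -/
theorem exists_affine_of_locally_affine {I : Set ℝ} (hI : IsOpen I) (hne : I.Nonempty)
    (hc : IsPreconnected I) {f u : ℝ → ℝ} (hf : InjOn f I)
    (hu : ∀ x ∈ I, ∃ c d, ∀ᶠ t in 𝓝 x, u t = c * f t + d) :
    ∃ c d, ∀ x ∈ I, u x = c * f x + d := by
  have huniq : ∀ x ∈ I, ∀ c d c' d', (∀ᶠ t in 𝓝 x, u t = c * f t + d) →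
      (∀ᶠ t in 𝓝 x, u t = c' * f t + d') → c = c' ∧ d = d' := by
    intro x hx c d c' d' h h'
    obtain ⟨y, ⟨⟨h1, h2⟩, hyI⟩, hyx⟩ := ((((h.and h').and (hI.mem_nhds hx)).filter_mono
      nhdsWithin_le_nhds).and (self_mem_nhdsWithin (a := x) (s := {x}ᶜ))).exists
    have h3 := h.self_of_nhds
    have h4 := h'.self_of_nhds
    have hne : f y - f x ≠ 0 := sub_ne_zero.2 fun e => hyx (hf hyI hx e)
    have hcc : c = c' := by
      apply mul_right_cancel₀ hne
      linarith
    subst hcc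
    exact ⟨rfl, by linarith⟩
  have hP : ∀ x ∈ I, ∀ y ∈ I, ∃ c d, (∀ᶠ t in 𝓝 x, u t = c * f t + d) ∧
      ∀ᶠ t in 𝓝 y, u t = c * f t + d := by
    intro x hx y hy
    refine hc.induction₂ (fun x y => ∃ c d, (∀ᶠ t in 𝓝 x, u t = c * f t + d) ∧
      ∀ᶠ t in 𝓝 y, u t = c * f t + d) ?_ ?_ ?_ hx hy
    · intro x hx
      obtain ⟨c, d, h⟩ := hu x hx
      exact (h.eventually_nhds.mono fun y hy => ⟨c, d, h, hy⟩).filter_mono nhdsWithin_le_nhds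
    · rintro x y z - hy - ⟨c, d, h1, h2⟩ ⟨c', d', h3, h4⟩
      obtain ⟨rfl, rfl⟩ := huniq y hy _ _ _ _ h2 h3
      exact ⟨c, d, h1, h4⟩
    · rintro x y - - ⟨c, d, h1, h2⟩
      exact ⟨c, d, h2, h1⟩
  obtain ⟨z, hz⟩ := hne
  obtain ⟨c, d, h⟩ := hu z hz
  refine ⟨c, d, fun x hx => ?_⟩
  obtain ⟨c', d', h1, h2⟩ := hP z hz x hx
  obtain ⟨rfl, rfl⟩ := huniq z hz _ _ _ _ h h1
  exact h2.self_of_nhds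

/-- For points of `U`, every value in `V` solving the defining equation of the mean of `f, p` also
solves the defining equation of the mean of `g, q`. -/
def MeanEqImp {n : ℕ} (V : Set ℝ) (U : Set (Fin n → ℝ)) (f g : ℝ → ℝ) (p q : Fin n → ℝ → ℝ) :
    Prop :=
  ∀ x ∈ U, ∀ y ∈ V, ∑ l, p l (x l) * (f (x l) - f y) = 0 →
    ∑ l, q l (x l) * (g (x l) - g y) = 0

theorem exists_weighted_sub_eq {f p : ℝ → ℝ} {α β y v : ℝ} (hαβ : α ≤ β)
    (hf : ContinuousOn f (Icc α β)) (hp : ContinuousOn p (Icc α β))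
    (h1 : p α * (f α - f y) ≤ v) (h2 : v ≤ p β * (f β - f y)) :
    ∃ t ∈ Icc α β, p t * (f t - f y) = v :=
  intermediate_value_Icc hαβ (hp.mul (hf.sub continuousOn_const)) ⟨h1, h2⟩

theorem MeanEqImp.exists_nhds_proportional {n : ℕ} {I : Set ℝ} {U : Set (Fin n → ℝ)}
    {f g : ℝ → ℝ} {p q : Fin n → ℝ → ℝ} (h : MeanEqImp I U f g p q) (hI : IsOpen I)
    (hU : IsOpen U) (hf : StrictMonoOn f I) (hg : StrictMonoOn g I) (hfc : ContinuousOn f I)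
    (hp : ∀ l, ∀ x ∈ I, 0 < p l x) (hq : ∀ l, ∀ x ∈ I, 0 < q l x)
    (hpc : ∀ l, ContinuousOn (p l) I) {z : ℝ} (hz : z ∈ I) (hzU : Function.const (Fin n) z ∈ U)
    {a b c : Fin n} (hab : a ≠ b) (hbc : b ≠ c) (hac : a ≠ c) :
    ∃ N ∈ 𝓝 z, N ⊆ I ∧ ∀ y ∈ N, ∃ k, ∀ t ∈ N,
      q a t * (g t - g y) = k * (p a t * (f t - f y)) ∧
      q b t * (g t - g y) = k * (p b t * (f t - f y)) := by
  obtain ⟨r₁, hr₁, hr₁I⟩ := Metric.isOpen_iff.1 hI z hz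
  obtain ⟨r₂, hr₂, hr₂U⟩ := Metric.isOpen_iff.1 hU _ hzU
  obtain ⟨r, hr, hrr₁, hrr₂⟩ : ∃ r, 0 < r ∧ r < r₁ ∧ r < r₂ :=
    ⟨min r₁ r₂ / 2, by positivity, by linarith [min_le_left r₁ r₂, lt_min hr₁ hr₂],
      by linarith [min_le_right r₁ r₂, lt_min hr₁ hr₂]⟩
  set V := Icc (z - r) (z + r) with hV
  have hVI : V ⊆ I := fun t ht => hr₁I (by
    rw [Metric.mem_ball, Real.dist_eq, abs_lt]; constructor <;> linarith [ht.1, ht.2])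
  have hVU : ∀ x : Fin n → ℝ, (∀ l, x l ∈ V) → x ∈ U := fun x hx => hr₂U (by
    rw [Metric.mem_ball, dist_pi_lt_iff hr₂]
    intro l
    rw [Function.const_apply, Real.dist_eq, abs_lt]
    constructor <;> linarith [(hx l).1, (hx l).2])
  have hzV : V ∈ 𝓝 z := Icc_mem_nhds (by linarith) (by linarith)
  have hlV : z - r ∈ V := ⟨le_rfl, by linarith⟩
  have hrV : z + r ∈ V := ⟨by linarith, le_rfl⟩
  have hfz : ContinuousAt f z := hfc.continuousAt (hI.mem_nhds hz)
  have hpz : ∀ l, ContinuousAt (p l) z := fun l => (hpc l).continuousAt (hI.mem_nhds hz)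
  have hatt : ∀ l, ∃ ε > 0, ∀ᶠ y in 𝓝 z, ∀ v, |v| < ε →
      ∃ t ∈ V, p l t * (f t - f y) = v := by
    intro l
    have hA : 0 < p l (z - r) * (f z - f (z - r)) :=
      mul_pos (hp l _ (hVI hlV)) (sub_pos.2 (hf (hVI hlV) hz (by linarith)))
    have hB : 0 < p l (z + r) * (f (z + r) - f z) :=
      mul_pos (hp l _ (hVI hrV)) (sub_pos.2 (hf hz (hVI hrV) (by linarith)))
    obtain ⟨ε, hε, hεm⟩ := exists_between (lt_min hA hB)
    obtain ⟨hεA, hεB⟩ := lt_min_iff.1 hεm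
    have e1 : ∀ᶠ y in 𝓝 z, ε < p l (z - r) * (f y - f (z - r)) :=
      (continuousAt_const.mul (hfz.sub continuousAt_const)).eventually_const_lt hεA
    have e2 : ∀ᶠ y in 𝓝 z, ε < p l (z + r) * (f (z + r) - f y) :=
      (continuousAt_const.mul (continuousAt_const.sub hfz)).eventually_const_lt hεB
    refine ⟨ε, hε, ?_⟩
    filter_upwards [e1, e2] with y h1 h2 v hv
    obtain ⟨hv1, hv2⟩ := abs_lt.1 hv
    exact exists_weighted_sub_eq (by linarith) (hfc.mono hVI) ((hpc l).mono hVI)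
      (by linarith) (by linarith)
  obtain ⟨ε₁, hε₁, hatt₁⟩ := hatt a
  obtain ⟨ε₂, hε₂, hatt₂⟩ := hatt b
  obtain ⟨ε₃, hε₃, hatt₃⟩ := hatt c
  obtain ⟨ε, hε, hεm⟩ := exists_between (lt_min hε₁ (lt_min hε₂ hε₃))
  simp only [lt_min_iff] at hεm
  obtain ⟨hε1, hε2, hε3⟩ := hεm
  have hsmall : ∀ l, ∀ᶠ w in 𝓝 z ×ˢ 𝓝 z, |p l w.1 * (f w.1 - f w.2)| < ε / 2 := by
    intro l
    have hfst : Tendsto (Prod.fst : ℝ × ℝ → ℝ) (𝓝 z ×ˢ 𝓝 z) (𝓝 z) := tendsto_fst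
    have hsnd : Tendsto (Prod.snd : ℝ × ℝ → ℝ) (𝓝 z ×ˢ 𝓝 z) (𝓝 z) := tendsto_snd
    have := (((hpz l).tendsto.comp hfst).mul
      ((hfz.tendsto.comp hfst).sub (hfz.tendsto.comp hsnd))).abs
    rw [sub_self, mul_zero, abs_zero] at this
    exact this.eventually_lt_const (by positivity)
  obtain ⟨N, hN, hNs⟩ := eventually_prod_self_iff'.1 ((hsmall a).and (hsmall b))
  refine ⟨N ∩ (V ∩ {y | (∀ v, |v| < ε₁ → ∃ t ∈ V, p a t * (f t - f y) = v) ∧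
      (∀ v, |v| < ε₂ → ∃ t ∈ V, p b t * (f t - f y) = v) ∧
      (∀ v, |v| < ε₃ → ∃ t ∈ V, p c t * (f t - f y) = v)}),
    inter_mem hN (inter_mem hzV (hatt₁.and (hatt₂.and hatt₃))),
    fun t ht => hVI ht.2.1, ?_⟩
  rintro y ⟨hyN, hyV, hy1, hy2, hy3⟩
  obtain ⟨k, hk⟩ := exists_proportional_of_sum_eq_zero (V := V) (y := y)
    (w₁ := fun t => p a t * (f t - f y)) (w₂ := fun t => p b t * (f t - f y))
    (w₃ := fun t => p c t * (f t - f y)) (u₁ := fun t => q a t * (g t - g y))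
    (u₂ := fun t => q b t * (g t - g y)) (u₃ := fun t => q c t * (g t - g y))
    hyV (by simp) (by simp) (by simp) (by simp) hε
    (fun v hv => hy1 v (hv.trans hε1)) (fun v hv => hy2 v (hv.trans hε2))
    (fun v hv => hy3 v (hv.trans hε3))
    (by
      intro t₁ h₁ t₂ h₂ t₃ h₃ h0
      have := h (fun m => if m = a then t₁ else if m = b then t₂ else if m = c then t₃ else y)
        (hVU _ fun l => by
          split_ifs <;> assumption)
        y (hVI hyV)
      rw [sum_ite_three (fun m t => p m t * (f t - f y)) (by simp) hab hbc hac,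
        sum_ite_three (fun m t => q m t * (g t - g y)) (by simp) hab hbc hac] at this
      exact this h0)
    (by
      intro t ht h0
      have h1 : 0 ≤ f t - f y := nonneg_of_mul_nonneg_right h0 (hp a t (hVI ht))
      have h2 : y ≤ t := (hf.le_iff_le (hVI hyV) (hVI ht)).1 (sub_nonneg.1 h1)
      exact mul_nonneg (hq a t (hVI ht)).le
        (sub_nonneg.2 ((hg.le_iff_le (hVI hyV) (hVI ht)).2 h2)))
  refine ⟨k, fun t ht => ⟨(hk t ht.2.1).1 ?_, (hk t ht.2.1).2 ?_⟩⟩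
  · exact (hNs t ht.1 y hyN).1
  · exact (hNs t ht.1 y hyN).2

theorem MeanEqImp.exists_affine_of_strictMonoOn {n : ℕ} {I : Set ℝ} {U : Set (Fin n → ℝ)}
    {f g : ℝ → ℝ} {p q : Fin n → ℝ → ℝ} (h : MeanEqImp I U f g p q) (hI : IsOpen I)
    (hne : I.Nonempty) (hconn : IsPreconnected I)
    (hU : IsOpen U) (hf : StrictMonoOn f I) (hg : StrictMonoOn g I) (hfc : ContinuousOn f I)
    (hp : ∀ l, ∀ x ∈ I, 0 < p l x) (hq : ∀ l, ∀ x ∈ I, 0 < q l x)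
    (hpc : ∀ l, ContinuousOn (p l) I) (hdiag : ∀ x ∈ I, Function.const (Fin n) x ∈ U)
    {i j k : Fin n} (hij : i ≠ j) (hjk : j ≠ k) (hik : i ≠ k) :
    ∃ a b c d : ℝ, ∀ x ∈ I, (∀ l, q l x = (c * f x + d) * p l x) ∧
      (c * f x + d) * g x = a * f x + b := by
  have hother : ∀ z : ℝ, ∀ N ∈ 𝓝 z, ∃ y ∈ N, y ≠ z := by
    intro z N hN
    obtain ⟨y, hy, hyz⟩ := ((Filter.Eventually.filter_mono (nhdsWithin_le_nhds (s := {z}ᶜ)) hN).and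
      self_mem_nhdsWithin).exists
    exact ⟨y, hy, hyz⟩
  have hratio : ∀ l, ∀ x ∈ I, q l x = q i x / p i x * p l x := by
    intro l x hx
    have hpi := (hp i x hx).ne'
    rcases eq_or_ne i l with rfl | hil
    · field_simp
    obtain ⟨m, hlm, him⟩ : ∃ m, l ≠ m ∧ i ≠ m := by
      rcases eq_or_ne l j with rfl | hlj
      · exact ⟨k, hjk, hik⟩
      · exact ⟨j, hlj, hij⟩
    obtain ⟨N, hN, hNI, hprop⟩ := h.exists_nhds_proportional hI hU hf hg hfc hp hq hpc hx
      (hdiag x hx) hil hlm him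
    obtain ⟨y, hy, hyx⟩ := hother x N hN
    obtain ⟨c, hc⟩ := hprop y hy
    obtain ⟨h1, h2⟩ := hc x (mem_of_mem_nhds hN)
    have hgne : g x - g y ≠ 0 := sub_ne_zero.2 fun e => hyx (hg.injOn hx (hNI hy) e).symm
    have : (q l x * p i x) * (g x - g y) = (q i x * p l x) * (g x - g y) := by
      linear_combination p i x * h2 - p l x * h1
    have := mul_right_cancel₀ hgne this
    field_simp
    linarith
  have hloc : ∀ z ∈ I, ∃ a b c d, ∀ᶠ t in 𝓝 z, q i t / p i t = c * f t + d ∧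
      q i t / p i t * g t = a * f t + b := by
    intro z hz
    obtain ⟨N, hN, hNI, hprop⟩ := h.exists_nhds_proportional hI hU hf hg hfc hp hq hpc hz
      (hdiag z hz) hij hjk hik
    obtain ⟨y, hy, hyz⟩ := hother z N hN
    obtain ⟨c₁, hc₁⟩ := hprop y hy
    obtain ⟨c₂, hc₂⟩ := hprop z (mem_of_mem_nhds hN)
    have hgne : g z - g y ≠ 0 := sub_ne_zero.2 fun e => hyz (hg.injOn hz (hNI hy) e).symm
    refine ⟨(c₁ - c₂) / (g z - g y) * g y + c₁,
      (c₂ * f z - c₁ * f y) / (g z - g y) * g y - c₁ * f y, (c₁ - c₂) / (g z - g y),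
      (c₂ * f z - c₁ * f y) / (g z - g y), ?_⟩
    filter_upwards [hN] with t ht
    have hpi := (hp i t (hNI ht)).ne'
    have h1 : q i t / p i t * (g t - g y) = c₁ * (f t - f y) := by
      field_simp
      linarith [(hc₁ t ht).1]
    have h2 : q i t / p i t * (g t - g z) = c₂ * (f t - f z) := by
      field_simp
      linarith [(hc₂ t ht).1]
    have h3 : q i t / p i t =
        (c₁ - c₂) / (g z - g y) * f t + (c₂ * f z - c₁ * f y) / (g z - g y) := by
      rw [div_mul_eq_mul_div, ← add_div, eq_div_iff hgne]
      linear_combination h1 - h2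
    exact ⟨h3, by linear_combination h1 + g y * h3⟩
  obtain ⟨c, d, hcd⟩ := exists_affine_of_locally_affine hI hne hconn hf.injOn
    (u := fun t => q i t / p i t) fun z hz => by
      obtain ⟨a, b, c, d, h⟩ := hloc z hz
      exact ⟨c, d, h.mono fun t ht => ht.1⟩
  obtain ⟨a, b, hab⟩ := exists_affine_of_locally_affine hI hne hconn hf.injOn
    (u := fun t => q i t / p i t * g t) fun z hz => by
      obtain ⟨a, b, c, d, h⟩ := hloc z hz
      exact ⟨a, b, h.mono fun t ht => ht.2⟩
  refine ⟨a, b, c, d, fun x hx => ⟨fun l => ?_, ?_⟩⟩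
  · rw [← hcd x hx]
    exact hratio l x hx
  · rw [← hcd x hx]
    exact hab x hx

theorem MeanEqImp.neg_left {n : ℕ} {I : Set ℝ} {U : Set (Fin n → ℝ)} {f g : ℝ → ℝ}
    {p q : Fin n → ℝ → ℝ} (h : MeanEqImp I U f g p q) :
    MeanEqImp I U (fun x => -f x) g p q := fun x hx y hy h0 => h x hx y hy <| by
  rw [← neg_eq_zero, ← h0, ← Finset.sum_neg_distrib]
  exact Finset.sum_congr rfl fun l _ => by ring

theorem MeanEqImp.neg_right {n : ℕ} {I : Set ℝ} {U : Set (Fin n → ℝ)} {f g : ℝ → ℝ}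
    {p q : Fin n → ℝ → ℝ} (h : MeanEqImp I U f g p q) :
    MeanEqImp I U f (fun x => -g x) p q := fun x hx y hy h0 => by
  rw [← neg_eq_zero, ← h x hx y hy h0, ← Finset.sum_neg_distrib]
  exact Finset.sum_congr rfl fun l _ => by ring

theorem MeanEqImp.exists_affine {n : ℕ} {I : Set ℝ} {U : Set (Fin n → ℝ)}
    {f g : ℝ → ℝ} {p q : Fin n → ℝ → ℝ} (h : MeanEqImp I U f g p q) (hI : IsOpen I)
    (hne : I.Nonempty) (hconn : IsPreconnected I) (hU : IsOpen U)
    (hf : StrictMonoOn f I ∨ StrictAntiOn f I) (hg : StrictMonoOn g I ∨ StrictAntiOn g I)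
    (hfc : ContinuousOn f I)
    (hp : ∀ l, ∀ x ∈ I, 0 < p l x) (hq : ∀ l, ∀ x ∈ I, 0 < q l x)
    (hpc : ∀ l, ContinuousOn (p l) I) (hdiag : ∀ x ∈ I, Function.const (Fin n) x ∈ U)
    {i j k : Fin n} (hij : i ≠ j) (hjk : j ≠ k) (hik : i ≠ k) :
    ∃ a b c d : ℝ, ∀ x ∈ I, (∀ l, q l x = (c * f x + d) * p l x) ∧
      (c * f x + d) * g x = a * f x + b := by
  wlog hfm : StrictMonoOn f I generalizing f
  · have hfa := hf.resolve_left hfm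
    obtain ⟨a, b, c, d, H⟩ := this h.neg_left (Or.inl hfa.neg) hfc.neg hfa.neg
    refine ⟨-a, b, -c, d, fun x hx => ⟨fun l => ?_, ?_⟩⟩
    · linear_combination (H x hx).1 l
    · linear_combination (H x hx).2
  wlog hgm : StrictMonoOn g I generalizing g
  · have hga := hg.resolve_left hgm
    obtain ⟨a, b, c, d, H⟩ := this (Or.inl hga.neg) h.neg_right hga.neg
    refine ⟨-a, -b, c, d, fun x hx => ⟨fun l => (H x hx).1 l, ?_⟩⟩
    linear_combination -(H x hx).2
  exact h.exists_affine_of_strictMonoOn hI hne hconn hU hfm hgm hfc hp hq hpc hdiag hij hjk hik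

/-- For continuous `f`, the mean of a point of `Iⁿ` lies in `I`, and its `f`-value is the weighted
average of the `f`-values of the coordinates. -/
theorem bmean_mem_and_apply {n : ℕ} (hn : 0 < n) {I : Set ℝ} (hconn : IsPreconnected I)
    {f finv : ℝ → ℝ} (hfc : ContinuousOn f I) (hleft : ∀ x ∈ I, finv (f x) = x)
    {p : Fin n → ℝ → ℝ} (hp : ∀ l, ∀ x ∈ I, 0 < p l x) {x : Fin n → ℝ} (hx : ∀ l, x l ∈ I) :
    bmean f finv p x ∈ I ∧
      f (bmean f finv p x) = (∑ l, p l (x l) * f (x l)) / ∑ l, p l (x l) := by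
  have hconv : Convex ℝ (f '' I) := (hconn.image f hfc).ordConnected.convex
  have : Nonempty (Fin n) := ⟨⟨0, hn⟩⟩
  have hpos : 0 < ∑ l, p l (x l) :=
    Finset.sum_pos (fun l _ => hp l _ (hx l)) Finset.univ_nonempty
  have hmem : (∑ l, p l (x l) * f (x l)) / ∑ l, p l (x l) ∈ f '' I := by
    have := hconv.centerMass_mem (t := Finset.univ) (w := fun l => p l (x l))
      (z := fun l => f (x l)) (fun l _ => (hp l _ (hx l)).le) hpos
      (fun l _ => mem_image_of_mem f (hx l))
    rwa [Finset.centerMass, smul_eq_mul, inv_mul_eq_div] at this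
  obtain ⟨y, hy, hfy⟩ := hmem
  have hb : bmean f finv p x = y := by rw [bmean, ← hfy, hleft y hy]
  rw [hb]
  exact ⟨hy, hfy⟩

theorem sum_mul_sub_eq_zero_iff {ι : Type*} [Fintype ι] {w u : ι → ℝ} {c : ℝ}
    (hw : ∑ l, w l ≠ 0) :
    ∑ l, w l * (u l - c) = 0 ↔ c = (∑ l, w l * u l) / ∑ l, w l := by
  simp only [mul_sub, Finset.sum_sub_distrib, ← Finset.sum_mul]
  rw [eq_div_iff hw, sub_eq_zero, mul_comm c, eq_comm]

/-- Theorem eq3 (main result, `n ≥ 3`): equivalence of (i) equality of the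
means on `Iⁿ`, (ii) equality on an open set containing the diagonal, and
(iv) the canonical relations `g = (af+b)/(cf+d)`, `q_ℓ = (cf+d)p_ℓ` with
`ad ≠ bc`. -/
theorem stmt_18 (I : Set ℝ) (hIopen : IsOpen I) (hIne : I.Nonempty)
    (hIconn : I.OrdConnected) (n : ℕ) (hn : 3 ≤ n) (f g : ℝ → ℝ)
    (hfd : DifferentiableOn ℝ f I) (hfd2 : DifferentiableOn ℝ (deriv f) I)
    (hfd3 : DifferentiableOn ℝ (deriv (deriv f)) I)
    (hgd : DifferentiableOn ℝ g I) (hgd2 : DifferentiableOn ℝ (deriv g) I)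
    (hgd3 : DifferentiableOn ℝ (deriv (deriv g)) I)
    (hf' : ∀ x ∈ I, deriv f x ≠ 0) (hg' : ∀ x ∈ I, deriv g x ≠ 0)
    (hf : StrictMonoOn f I ∨ StrictAntiOn f I)
    (hg : StrictMonoOn g I ∨ StrictAntiOn g I)
    (finvf : ℝ → ℝ)
    (hfmaps : Set.MapsTo finvf (convexHull ℝ (f '' I)) I)
    (hfmono : MonotoneOn finvf (convexHull ℝ (f '' I)) ∨
      AntitoneOn finvf (convexHull ℝ (f '' I)))
    (hfleft : ∀ x ∈ I, finvf (f x) = x)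
    (finvg : ℝ → ℝ)
    (hgmaps : Set.MapsTo finvg (convexHull ℝ (g '' I)) I)
    (hgmono : MonotoneOn finvg (convexHull ℝ (g '' I)) ∨
      AntitoneOn finvg (convexHull ℝ (g '' I)))
    (hgleft : ∀ x ∈ I, finvg (g x) = x)
    (p q : Fin n → ℝ → ℝ)
    (hp : ∀ l, ∀ x ∈ I, 0 < p l x) (hq : ∀ l, ∀ x ∈ I, 0 < q l x)
    (hpc : ∀ l, ContinuousOn (p l) I)
    (i j k : Fin n) (hij : i ≠ j) (hjk : j ≠ k) (hik : i ≠ k)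
    (hpi : DifferentiableOn ℝ (p i) I) (hpj : DifferentiableOn ℝ (p j) I)
    (hpk : DifferentiableOn ℝ (p k) I) :
    ((∀ x : Fin n → ℝ, (∀ l, x l ∈ I) →
        bmean f finvf p x = bmean g finvg q x) ↔
      (∃ a b c d : ℝ, a * d ≠ b * c ∧
        (∀ x ∈ I, g x = (a * f x + b) / (c * f x + d)) ∧
        (∀ l : Fin n, ∀ x ∈ I, q l x = (c * f x + d) * p l x))) ∧
    ((∃ U : Set (Fin n → ℝ), IsOpen U ∧
        U ⊆ {y : Fin n → ℝ | ∀ l, y l ∈ I} ∧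
        (∀ x ∈ I, Function.const (Fin n) x ∈ U) ∧
        ∀ y ∈ U, bmean f finvf p y = bmean g finvg q y) ↔
      (∃ a b c d : ℝ, a * d ≠ b * c ∧
        (∀ x ∈ I, g x = (a * f x + b) / (c * f x + d)) ∧
        (∀ l : Fin n, ∀ x ∈ I, q l x = (c * f x + d) * p l x))) := by
  have hconn : IsPreconnected I := hIconn.isPreconnected
  have hn0 : 0 < n := by omega
  have : Nonempty (Fin n) := ⟨i⟩
  have hfc := hfd.continuousOn
  have hgc := hgd.continuousOn
  have hfinj : InjOn f I := hf.elim StrictMonoOn.injOn StrictAntiOn.injOn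
  have hginj : InjOn g I := hg.elim StrictMonoOn.injOn StrictAntiOn.injOn
  have hsum : ∀ {w : Fin n → ℝ → ℝ} (_ : ∀ l, ∀ x ∈ I, 0 < w l x) {x : Fin n → ℝ},
      (∀ l, x l ∈ I) → ∑ l, w l (x l) ≠ 0 := fun hw x hx =>
    (Finset.sum_pos (fun l _ => hw l _ (hx l)) Finset.univ_nonempty).ne'
  have hIU : IsOpen {y : Fin n → ℝ | ∀ l, y l ∈ I} := by
    simp only [ofPred_forall]
    exact isOpen_iInter_of_finite fun l => hIopen.preimage (continuous_apply l)
  have hglobal : (∃ a b c d : ℝ, a * d ≠ b * c ∧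
        (∀ x ∈ I, g x = (a * f x + b) / (c * f x + d)) ∧
        (∀ l : Fin n, ∀ x ∈ I, q l x = (c * f x + d) * p l x)) →
      ∀ x : Fin n → ℝ, (∀ l, x l ∈ I) → bmean f finvf p x = bmean g finvg q x := by
    rintro ⟨a, b, c, d, -, hgf, hqp⟩ x hx
    have hden : ∀ y ∈ I, 0 < c * f y + d := fun y hy =>
      pos_of_mul_pos_left (hqp i y hy ▸ hq i y hy) (hp i y hy).le
    obtain ⟨hyI, hy⟩ := bmean_mem_and_apply hn0 hconn hfc hfleft hp hx
    obtain ⟨hyI', hy'⟩ := bmean_mem_and_apply hn0 hconn hgc hgleft hq hx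
    refine hginj hyI hyI' ?_
    rw [hy']
    have hterm := (sum_mul_sub_eq_zero_iff (hsum hp hx)).2 hy
    refine (sum_mul_sub_eq_zero_iff (hsum hq hx)).1 ?_
    set y := bmean f finvf p x
    calc ∑ l, q l (x l) * (g (x l) - g y)
        = ∑ l, (a * d - b * c) / (c * f y + d) * (p l (x l) * (f (x l) - f y)) := by
          refine Finset.sum_congr rfl fun l _ => ?_
          have h1 := (hden _ (hx l)).ne'
          have h2 := (hden _ hyI).ne'
          rw [hqp l _ (hx l), hgf _ (hx l), hgf _ hyI]
          field_simp
          ring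
      _ = 0 := by rw [← Finset.mul_sum, hterm, mul_zero]
  have hlocal : (∃ U : Set (Fin n → ℝ), IsOpen U ∧
        U ⊆ {y : Fin n → ℝ | ∀ l, y l ∈ I} ∧
        (∀ x ∈ I, Function.const (Fin n) x ∈ U) ∧
        ∀ y ∈ U, bmean f finvf p y = bmean g finvg q y) →
      (∃ a b c d : ℝ, a * d ≠ b * c ∧
        (∀ x ∈ I, g x = (a * f x + b) / (c * f x + d)) ∧
        (∀ l : Fin n, ∀ x ∈ I, q l x = (c * f x + d) * p l x)) := by
    rintro ⟨U, hU, hUI, hdiag, hmean⟩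
    have himp : MeanEqImp I U f g p q := by
      intro x hxU y hy h0
      have hx := hUI hxU
      obtain ⟨hmI, hm⟩ := bmean_mem_and_apply hn0 hconn hfc hfleft hp hx
      obtain ⟨-, hm'⟩ := bmean_mem_and_apply hn0 hconn hgc hgleft hq hx
      rw [sum_mul_sub_eq_zero_iff (hsum hp hx), ← hm] at h0
      rw [sum_mul_sub_eq_zero_iff (hsum hq hx), ← hm', ← hmean x hxU, hfinj hy hmI h0]
    obtain ⟨a, b, c, d, H⟩ := himp.exists_affine hIopen hIne hconn hU hf hg hfc hp hq hpc hdiag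
      hij hjk hik
    have hden : ∀ y ∈ I, 0 < c * f y + d := fun y hy =>
      pos_of_mul_pos_left ((H y hy).1 i ▸ hq i y hy) (hp i y hy).le
    have hgf : ∀ x ∈ I, g x = (a * f x + b) / (c * f x + d) := fun x hx => by
      rw [eq_div_iff (hden x hx).ne', mul_comm]
      exact (H x hx).2
    refine ⟨a, b, c, d, fun hdet => ?_, hgf, fun l x hx => (H x hx).1 l⟩
    obtain ⟨x, hx⟩ := hIne
    obtain ⟨y, hy, hyx⟩ := ((Filter.Eventually.filter_mono (nhdsWithin_le_nhds (s := {x}ᶜ))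
      (hIopen.mem_nhds hx)).and self_mem_nhdsWithin).exists
    refine hyx (hginj hy hx ?_)
    rw [hgf x hx, hgf y hy, div_eq_div_iff (hden y hy).ne' (hden x hx).ne']
    linear_combination (f y - f x) * hdet
  refine ⟨⟨fun h => hlocal ⟨_, hIU, Subset.rfl, fun x hx _ => hx, h⟩, hglobal⟩,
    ⟨hlocal, fun h => ⟨_, hIU, Subset.rfl, fun x hx _ => hx, hglobal h⟩⟩⟩
end

section
/- Let I be a nonempty open real interval, let f, g: I → ℝ be three times differentiable on I with nonvanishing first derivatives, and let p = (p_1,p_2): I → ℝ_+² and q = (q_1,q_2): I → ℝ_+² with p_1 ≠ p_2. Assume there exists i ∈ {1,2} such that either (a) p_i is twice continuously differentiable and p_{3−i} is continuous on I, or (b) p_i is twice differentiable and p_{3−i} is once differentiable on I. Then the following are equivalent: (i) A_{f,p} = A_{g,q} on I²; (ii) there is an open subset U of I² containing the diagonal diag(I²) such that A_{f,p} = A_{g,q} on U; (iv) there exist a, b, c, d ∈ ℝ with ad ≠ bc such that g = (af + b)/(cf + d), q_1 = (cf + d)·p_1, and q_2 = (cf + d)·p_2 hold on I. -/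
/-- The two-variable generalized Bajraktarević mean built from `f`, its
generalized left inverse `finv`, and the weight functions `p₁, p₂`. -/
noncomputable def bmean2 (f finv p₁ p₂ : ℝ → ℝ) (x₁ x₂ : ℝ) : ℝ :=
  finv ((p₁ x₁ * f x₁ + p₂ x₂ * f x₂) / (p₁ x₁ + p₂ x₂))

section

open Set Filter Topology

theorem eq_of_forall_hasDerivAt_zero {s : Set ℝ} (hs : Convex ℝ s) {F : ℝ → ℝ}
    (hF : ∀ x ∈ s, HasDerivAt F 0 x) {x y : ℝ} (hx : x ∈ s) (hy : y ∈ s) : F x = F y := by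
  have := hs.norm_image_sub_le_of_norm_hasDerivWithin_le (f := F) (f' := fun _ => 0) (C := 0)
    (fun z hz => (hF z hz).hasDerivWithinAt) (by simp) hy hx
  simpa [sub_eq_zero] using this

theorem isLittleO_pow_succ_of_hasDerivAt {F F' : ℝ → ℝ} {x₀ : ℝ} {n : ℕ}
    (hF : ∀ᶠ x in 𝓝 x₀, HasDerivAt F (F' x) x) (h0 : F x₀ = 0)
    (hF' : F' =o[𝓝 x₀] fun x => (x - x₀) ^ n) :
    F =o[𝓝 x₀] fun x => (x - x₀) ^ (n + 1) := by
  obtain ⟨ε, hε, hball⟩ := Metric.eventually_nhds_iff_ball.1 hF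
  have hx₀ : x₀ ∈ Metric.ball x₀ ε := Metric.mem_ball_self hε
  have hn : 𝓝[Metric.ball x₀ ε] x₀ = 𝓝 x₀ :=
    nhdsWithin_eq_nhds.2 (Metric.isOpen_ball.mem_nhds hx₀)
  have := (convex_ball x₀ ε).isLittleO_pow_succ_real hx₀ (f := F) (f' := F') (n := n)
    (fun x hx => (hball x hx).hasDerivWithinAt) (by rwa [hn])
  simpa [hn, h0] using this

theorem exists_quadratic_remainder {r r₁ : ℝ → ℝ} {c x₀ : ℝ}
    (hr : ∀ᶠ x in 𝓝 x₀, HasDerivAt r (r₁ x) x) (hr₁ : HasDerivAt r₁ c x₀) :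
    ∃ E : ℝ → ℝ, Tendsto E (𝓝 0) (𝓝 0) ∧
      ∀ t, r (x₀ + t) = r x₀ + r₁ x₀ * t + c / 2 * t ^ 2 + E t * t ^ 2 := by
  have hO : (fun x => r x - (r x₀ + r₁ x₀ * (x - x₀) + c / 2 * (x - x₀) ^ 2))
      =o[𝓝 x₀] fun x => (x - x₀) ^ 2 := by
    refine isLittleO_pow_succ_of_hasDerivAt (n := 1)
      (F' := fun x => r₁ x - (r₁ x₀ + c * (x - x₀))) ?_ (by simp) ?_
    · filter_upwards [hr] with x hx
      have hd := (hasDerivAt_id x).sub_const x₀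
      convert! hx.sub (((hd.const_mul (r₁ x₀)).const_add (r x₀)).add
        ((hd.pow 2).const_mul (c / 2))) using 1
      simp; ring
    · have := hasDerivAt_iff_isLittleO.1 hr₁
      simpa [sub_sub, mul_comm] using this
  have hshift : Tendsto (fun t : ℝ => x₀ + t) (𝓝 0) (𝓝 x₀) :=
    Continuous.tendsto' (by fun_prop) _ _ (by simp)
  refine ⟨_, ((hO.tendsto_div_nhds_zero).comp hshift), fun t => ?_⟩
  rcases eq_or_ne t 0 with rfl | ht
  · simp
  · simp only [Function.comp, add_sub_cancel_left]
    field_simp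
    ring

theorem exists_cubic_remainder {h h₁ h₂ : ℝ → ℝ} {c x₀ : ℝ}
    (hh : ∀ᶠ x in 𝓝 x₀, HasDerivAt h (h₁ x) x)
    (hh₁ : ∀ᶠ x in 𝓝 x₀, HasDerivAt h₁ (h₂ x) x) (hh₂ : HasDerivAt h₂ c x₀) :
    ∃ E : ℝ → ℝ, Tendsto E (𝓝 0) (𝓝 0) ∧
      ∀ t, h (x₀ + t) =
        h x₀ + h₁ x₀ * t + h₂ x₀ / 2 * t ^ 2 + c / 6 * t ^ 3 + E t * t ^ 3 := by
  have hO : (fun x => h x - (h x₀ + h₁ x₀ * (x - x₀) + h₂ x₀ / 2 * (x - x₀) ^ 2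
      + c / 6 * (x - x₀) ^ 3)) =o[𝓝 x₀] fun x => (x - x₀) ^ 3 := by
    refine isLittleO_pow_succ_of_hasDerivAt (n := 2)
      (F' := fun x => h₁ x - (h₁ x₀ + h₂ x₀ * (x - x₀) + c / 2 * (x - x₀) ^ 2)) ?_
      (by simp) ?_
    · filter_upwards [hh] with x hx
      have hd := (hasDerivAt_id x).sub_const x₀
      convert! hx.sub ((((hd.const_mul (h₁ x₀)).const_add (h x₀)).add
        ((hd.pow 2).const_mul (h₂ x₀ / 2))).add ((hd.pow 3).const_mul (c / 6))) using 1
      simp; ring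
    · refine isLittleO_pow_succ_of_hasDerivAt (n := 1)
        (F' := fun x => h₂ x - (h₂ x₀ + c * (x - x₀))) ?_ (by simp) ?_
      · filter_upwards [hh₁] with x hx
        have hd := (hasDerivAt_id x).sub_const x₀
        convert! hx.sub (((hd.const_mul (h₂ x₀)).const_add (h₁ x₀)).add
          ((hd.pow 2).const_mul (c / 2))) using 1
        simp; ring
      · have := hasDerivAt_iff_isLittleO.1 hh₂
        simpa [sub_sub, mul_comm] using this
  have hshift : Tendsto (fun t : ℝ => x₀ + t) (𝓝 0) (𝓝 x₀) :=
    Continuous.tendsto' (by fun_prop) _ _ (by simp)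
  refine ⟨_, ((hO.tendsto_div_nhds_zero).comp hshift), fun t => ?_⟩
  rcases eq_or_ne t 0 with rfl | ht
  · simp
  · simp only [Function.comp, add_sub_cancel_left]
    field_simp
    ring

/-- The mean of `y` and `z` with weights `P₁ y` and `P₂ z`. -/
noncomputable def weightedMean (P₁ P₂ : ℝ → ℝ) (y z : ℝ) : ℝ :=
  (P₁ y * y + P₂ z * z) / (P₁ y + P₂ z)

theorem weightedMean_swap (P₁ P₂ : ℝ → ℝ) (y z : ℝ) :
    weightedMean P₂ P₁ z y = weightedMean P₁ P₂ y z := by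
  simp only [weightedMean, add_comm]

theorem weightedMean_add {P₁ P₂ : ℝ → ℝ} {x t : ℝ} (hP : P₁ x + P₂ (x + t) ≠ 0) :
    weightedMean P₁ P₂ x (x + t) = x + P₂ (x + t) / (P₁ x + P₂ (x + t)) * t := by
  rw [weightedMean]
  field_simp
  ring

/-- The balance `R₁(y) h[y, m] = R₂(z) h[z, m]` of divided differences at the weighted mean `m` of
`y` and `z`, with denominators cleared. -/
def BalancedAt (h R₁ R₂ P₁ P₂ : ℝ → ℝ) (y z : ℝ) : Prop :=
  R₁ y * (h y - h (weightedMean P₁ P₂ y z)) * (z - weightedMean P₁ P₂ y z) =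
    R₂ z * (h z - h (weightedMean P₁ P₂ y z)) * (y - weightedMean P₁ P₂ y z)

theorem BalancedAt.swap {h R₁ R₂ P₁ P₂ : ℝ → ℝ} {y z : ℝ} (H : BalancedAt h R₁ R₂ P₁ P₂ y z) :
    BalancedAt h R₂ R₁ P₂ P₁ z y := by
  simp only [BalancedAt, weightedMean_swap P₁ P₂ y z]
  exact H.symm

/-- Expansion of the balance equation at a base point, for `t ≠ 0` and `μ ∉ {0, 1}`. -/
theorem balance_expansion {h E : ℝ → ℝ} {x a b c R S t μ : ℝ}
    (hE : ∀ t, h (x + t) = h x + a * t + b / 2 * t ^ 2 + c / 6 * t ^ 3 + E t * t ^ 3)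
    (ht : t ≠ 0) (hμ0 : μ ≠ 0) (hμ1 : 1 - μ ≠ 0)
    (H : R * (h x - h (x + μ * t)) * (x + t - (x + μ * t)) =
      S * (h (x + t) - h (x + μ * t)) * (x - (x + μ * t))) :
    R * (a + t * (b / 2 * μ + t * (μ ^ 2 * (c / 6 + E (μ * t))))) =
      S * (a + t * (b / 2 * (1 + μ) + t * (c / 6 * (1 + μ + μ ^ 2) +
        (E t - E (μ * t) * μ ^ 3) / (1 - μ)))) := by
  rw [hE t, hE (μ * t)] at H
  have hne : μ * (1 - μ) * t ^ 2 ≠ 0 := by positivity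
  apply mul_left_cancel₀ hne
  have hF : (E t - E (μ * t) * μ ^ 3) / (1 - μ) * (1 - μ) = E t - E (μ * t) * μ ^ 3 :=
    div_mul_cancel₀ _ hμ1
  linear_combination (-1) * H - S * μ * t ^ 4 * hF

theorem tendsto_weight_ratio {P₁ P₂ : ℝ → ℝ} {x : ℝ} (h₁ : 0 < P₁ x) (h₂ : 0 < P₂ x)
    (hc : ContinuousAt P₂ x) :
    Tendsto (fun t => P₂ (x + t) / (P₁ x + P₂ (x + t))) (𝓝 0) (𝓝 (P₂ x / (P₁ x + P₂ x))) := by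
  have hshift : Tendsto (fun t : ℝ => x + t) (𝓝 0) (𝓝 x) :=
    Continuous.tendsto' (by fun_prop) _ _ (by simp)
  have h := hc.tendsto.comp hshift
  exact h.div (h.const_add _) (by positivity)

theorem eventually_balance_expansion {h E R₁ R₂ P₁ P₂ : ℝ → ℝ} {x a b c : ℝ}
    (hE : ∀ t, h (x + t) = h x + a * t + b / 2 * t ^ 2 + c / 6 * t ^ 3 + E t * t ^ 3)
    (h₁ : 0 < P₁ x) (h₂ : 0 < P₂ x) (hc : ContinuousAt P₂ x)
    (H : ∀ᶠ z : ℝ × ℝ in 𝓝 (x, x), BalancedAt h R₁ R₂ P₁ P₂ z.1 z.2) :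
    ∃ μ : ℝ → ℝ, Tendsto μ (𝓝 0) (𝓝 (P₂ x / (P₁ x + P₂ x))) ∧
      ∀ᶠ t in 𝓝[≠] 0,
        R₁ x * (a + t * (b / 2 * μ t + t * (μ t ^ 2 * (c / 6 + E (μ t * t))))) =
          R₂ (x + t) * (a + t * (b / 2 * (1 + μ t) + t * (c / 6 * (1 + μ t + μ t ^ 2) +
            (E t - E (μ t * t) * μ t ^ 3) / (1 - μ t)))) := by
  refine ⟨_, tendsto_weight_ratio h₁ h₂ hc, ?_⟩
  have hshift : Tendsto (fun t : ℝ => x + t) (𝓝 0) (𝓝 x) :=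
    Continuous.tendsto' (by fun_prop) _ _ (by simp)
  have hpair : Tendsto (fun t : ℝ => (x, x + t)) (𝓝 0) (𝓝 (x, x)) :=
    Continuous.tendsto' (by fun_prop) _ _ (by simp)
  have hpos : ∀ᶠ t in 𝓝 (0 : ℝ), 0 < P₂ (x + t) := (hc.tendsto.comp hshift).eventually_const_lt h₂
  filter_upwards [nhdsWithin_le_nhds (hpair.eventually H), nhdsWithin_le_nhds hpos,
    self_mem_nhdsWithin] with t hbal hPt ht
  refine balance_expansion hE ht (by positivity) ?_ ?_
  · have : 1 - P₂ (x + t) / (P₁ x + P₂ (x + t)) = P₁ x / (P₁ x + P₂ (x + t)) := by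
      field_simp; ring
    rw [this]; positivity
  · simpa only [BalancedAt, weightedMean_add (by positivity : P₁ x + P₂ (x + t) ≠ 0)] using hbal

theorem tendsto_expansion_remainder {E μ : ℝ → ℝ} {c μ₀ : ℝ} (hE : Tendsto E (𝓝 0) (𝓝 0))
    (hμ : Tendsto μ (𝓝 0) (𝓝 μ₀)) (hμ₀ : 1 - μ₀ ≠ 0) :
    Tendsto (fun t => μ t ^ 2 * (c / 6 + E (μ t * t))) (𝓝 0) (𝓝 (μ₀ ^ 2 * (c / 6))) ∧
    Tendsto (fun t => c / 6 * (1 + μ t + μ t ^ 2) + (E t - E (μ t * t) * μ t ^ 3) / (1 - μ t))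
      (𝓝 0) (𝓝 (c / 6 * (1 + μ₀ + μ₀ ^ 2))) := by
  have hμt : Tendsto (fun t => μ t * t) (𝓝 0) (𝓝 0) := by
    simpa using hμ.mul (tendsto_id (α := ℝ))
  have hEμ := hE.comp hμt
  constructor
  · simpa using (hμ.pow 2).mul (hEμ.const_add (c / 6))
  · simpa [add_assoc] using (((hμ.const_add 1).add (hμ.pow 2)).const_mul (c / 6)).add
      ((hE.sub (hEμ.mul (hμ.pow 3))).div (hμ.const_sub 1) hμ₀)

theorem one_sub_weight_ratio_ne_zero {p q : ℝ} (hp : 0 < p) (hq : 0 < q) :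
    1 - q / (p + q) ≠ 0 := by
  have : 1 - q / (p + q) = p / (p + q) := by field_simp; ring
  rw [this]; positivity

/-- First-order consequence of the balance equation near a diagonal point. -/
theorem tendsto_slope_of_balanced {h E R₁ R₂ P₁ P₂ : ℝ → ℝ} {x a b c : ℝ}
    (hE0 : Tendsto E (𝓝 0) (𝓝 0))
    (hE : ∀ t, h (x + t) = h x + a * t + b / 2 * t ^ 2 + c / 6 * t ^ 3 + E t * t ^ 3)
    (ha : a ≠ 0) (h₁ : 0 < P₁ x) (h₂ : 0 < P₂ x) (hc : ContinuousAt P₂ x)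
    (H : ∀ᶠ z : ℝ × ℝ in 𝓝 (x, x), BalancedAt h R₁ R₂ P₁ P₂ z.1 z.2) :
    Tendsto (fun t => t⁻¹ * (R₂ (x + t) - R₁ x)) (𝓝[≠] 0) (𝓝 (-(b / (2 * a)) * R₁ x)) := by
  obtain ⟨μ, hμ, hev⟩ := eventually_balance_expansion hE h₁ h₂ hc H
  obtain ⟨hA, hB⟩ := tendsto_expansion_remainder (c := c) hE0 hμ (one_sub_weight_ratio_ne_zero h₁ h₂)
  set A := fun t => μ t ^ 2 * (c / 6 + E (μ t * t))
  set B := fun t => c / 6 * (1 + μ t + μ t ^ 2) + (E t - E (μ t * t) * μ t ^ 3) / (1 - μ t)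
  have hid : Tendsto (fun t : ℝ => t) (𝓝 0) (𝓝 0) := tendsto_id
  have hden : Tendsto (fun t => a + t * (b / 2 * (1 + μ t) + t * B t)) (𝓝 0) (𝓝 a) := by
    simpa using (hid.mul (((hμ.const_add 1).const_mul (b / 2)).add (hid.mul hB))).const_add a
  have hnum : Tendsto (fun t => R₁ x * (-(b / 2) + t * (A t - B t))) (𝓝 0)
      (𝓝 (R₁ x * -(b / 2))) := by
    simpa using ((hid.mul (hA.sub hB)).const_add (-(b / 2))).const_mul (R₁ x)
  have hlim := (hnum.div hden ha).mono_left (nhdsWithin_le_nhds (s := {0}ᶜ))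
  have hval : R₁ x * -(b / 2) / a = -(b / (2 * a)) * R₁ x := by field_simp
  rw [hval] at hlim
  refine hlim.congr' ?_
  filter_upwards [hev, self_mem_nhdsWithin, nhdsWithin_le_nhds (hden.eventually_ne ha)]
    with t h1 ht hne
  have ht : t ≠ 0 := ht
  have h1' : R₁ x * (a + t * (b / 2 * μ t + t * A t)) =
    R₂ (x + t) * (a + t * (b / 2 * (1 + μ t) + t * B t)) := h1
  simp only [Pi.div_apply]
  rw [div_eq_iff hne, mul_assoc, eq_inv_mul_iff_mul_eq₀ ht]
  linear_combination h1'

/-- Second-order consequence of the balance equation near a diagonal point. -/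
theorem second_deriv_mul_eq_zero_of_balanced {h E r ρ P₁ P₂ : ℝ → ℝ} {x a b c r₁ r₂ : ℝ}
    (hE0 : Tendsto E (𝓝 0) (𝓝 0))
    (hE : ∀ t, h (x + t) = h x + a * t + b / 2 * t ^ 2 + c / 6 * t ^ 3 + E t * t ^ 3)
    (hρ0 : Tendsto ρ (𝓝 0) (𝓝 0))
    (hρ : ∀ t, r (x + t) = r x + r₁ * t + r₂ / 2 * t ^ 2 + ρ t * t ^ 2)
    (hr₁ : 2 * (r₁ * a) + b * r x = 0) (hr₂ : 2 * (r₂ * a) + 3 * (b * r₁) + c * r x = 0)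
    (ha : a ≠ 0) (h₁ : 0 < P₁ x) (h₂ : 0 < P₂ x) (hc : ContinuousAt P₂ x)
    (hne : P₁ x ≠ P₂ x)
    (H : ∀ᶠ z : ℝ × ℝ in 𝓝 (x, x), BalancedAt h r r P₁ P₂ z.1 z.2) : r₂ = 0 := by
  obtain ⟨μ, hμ, hev⟩ := eventually_balance_expansion hE h₁ h₂ hc H
  obtain ⟨hA, hB⟩ := tendsto_expansion_remainder (c := c) hE0 hμ (one_sub_weight_ratio_ne_zero h₁ h₂)
  set A := fun t => μ t ^ 2 * (c / 6 + E (μ t * t))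
  set B := fun t => c / 6 * (1 + μ t + μ t ^ 2) + (E t - E (μ t * t) * μ t ^ 3) / (1 - μ t)
  set μ₀ := P₂ x / (P₁ x + P₂ x) with hμ₀
  have hid : Tendsto (fun t : ℝ => t) (𝓝 0) (𝓝 0) := tendsto_id
  have hρ2 : Tendsto (fun t => r₂ / 2 + ρ t) (𝓝 0) (𝓝 (r₂ / 2)) := by
    simpa using hρ0.const_add (r₂ / 2)
  have hC : Tendsto (fun t => b / 2 * (1 + μ t) + t * B t) (𝓝 0) (𝓝 (b / 2 * (1 + μ₀))) := by
    simpa using ((hμ.const_add 1).const_mul (b / 2)).add (hid.mul hB)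
  have hlim : Tendsto (fun t => r x * A t - (r x * B t + r₁ * (b / 2 * (1 + μ t) + t * B t) +
      (r₂ / 2 + ρ t) * (a + t * (b / 2 * (1 + μ t) + t * B t)))) (𝓝[≠] 0)
      (𝓝 (r x * (μ₀ ^ 2 * (c / 6)) - (r x * (c / 6 * (1 + μ₀ + μ₀ ^ 2)) +
        r₁ * (b / 2 * (1 + μ₀)) + r₂ / 2 * a))) := by
    refine Tendsto.mono_left ?_ nhdsWithin_le_nhds
    have hD : Tendsto (fun t => a + t * (b / 2 * (1 + μ t) + t * B t)) (𝓝 0) (𝓝 a) := by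
      simpa using (hid.mul hC).const_add a
    exact (hA.const_mul (r x)).sub (((hB.const_mul (r x)).add (hC.const_mul r₁)).add
      (hρ2.mul hD))
  have hzero : r x * (μ₀ ^ 2 * (c / 6)) - (r x * (c / 6 * (1 + μ₀ + μ₀ ^ 2)) +
        r₁ * (b / 2 * (1 + μ₀)) + r₂ / 2 * a) = 0 := by
    refine tendsto_nhds_unique hlim (tendsto_const_nhds.congr' ?_)
    filter_upwards [hev, self_mem_nhdsWithin] with t h1 ht
    have ht : t ≠ 0 := ht
    have h1' : r x * (a + t * (b / 2 * μ t + t * A t)) =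
      r (x + t) * (a + t * (b / 2 * (1 + μ t) + t * B t)) := h1
    rw [hρ t] at h1'
    refine mul_left_cancel₀ (pow_ne_zero 2 ht) ?_
    linear_combination (-1) * h1' - t / 2 * hr₁
  have hmul : r₂ * a * (2 * μ₀ - 1) = 0 := by
    linear_combination 6 * hzero + (1 + μ₀) * hr₂
  have hμne : 2 * μ₀ - 1 ≠ 0 := by
    have : 2 * μ₀ - 1 = (P₂ x - P₁ x) / (P₁ x + P₂ x) := by rw [hμ₀]; field_simp; ring
    rw [this]
    exact div_ne_zero (sub_ne_zero.2 hne.symm) (by positivity)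
  simpa [ha, hμne] using hmul

theorem tendsto_of_forall_tendsto_punctured {F G : ℝ → ℝ} {J : Set ℝ} (hJ : IsOpen J)
    (hFG : ∀ x ∈ J, Tendsto F (𝓝[≠] x) (𝓝 (G x))) {x : ℝ} (hx : x ∈ J) :
    Tendsto G (𝓝[≠] x) (𝓝 (G x)) := by
  rw [Metric.tendsto_nhds]
  intro ε hε
  have h := (Metric.tendsto_nhds.1 (hFG x hx)) (ε / 2) (half_pos hε)
  rw [eventually_nhdsWithin_iff] at h ⊢
  filter_upwards [h.eventually_nhds, hJ.mem_nhds hx] with w hw hwJ hwx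
  have hev : ∀ᶠ y in 𝓝[≠] w, dist (F y) (G x) < ε / 2 := by
    filter_upwards [nhdsWithin_le_nhds hw,
      nhdsWithin_le_nhds (isOpen_compl_singleton.mem_nhds hwx)] with y h₁ h₂ using h₁ h₂
  have := le_of_tendsto ((hFG w hwJ).dist tendsto_const_nhds) (hev.mono fun _ => le_of_lt)
  linarith

theorem eqOn_of_forall_tendsto_punctured {F G : ℝ → ℝ} {J : Set ℝ} (hJ : IsOpen J)
    (hFG : ∀ x ∈ J, Tendsto F (𝓝[≠] x) (𝓝 (G x)))
    (hGF : ∀ x ∈ J, Tendsto G (𝓝[≠] x) (𝓝 (F x))) : EqOn F G J := fun x hx =>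
  tendsto_nhds_unique (hGF x hx) (tendsto_of_forall_tendsto_punctured hJ hFG hx)

theorem eq_of_deriv_const {r r₁ : ℝ → ℝ} {κ : ℝ} {s : Set ℝ} (hs : Convex ℝ s)
    (hr : ∀ u ∈ s, HasDerivAt r (r₁ u) u) (hκ : ∀ u ∈ s, r₁ u = κ) {u d : ℝ}
    (hu : u ∈ s) (hd : d ∈ s) : r u = r d + κ * (u - d) := by
  have := eq_of_forall_hasDerivAt_zero hs (F := fun t => r t - κ * t) (fun t ht => by
    have := (hr t ht).sub ((hasDerivAt_id t).const_mul κ)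
    simpa [hκ t ht] using! this) hu hd
  linear_combination this

theorem mul_mul_sub_eq_of_deriv_const {h r r₁ : ℝ → ℝ} {D κ : ℝ} {s : Set ℝ} (hs : Convex ℝ s)
    (hpos : ∀ u ∈ s, 0 < r u) (hh : ∀ u ∈ s, HasDerivAt h (D / r u ^ 2) u)
    (hr : ∀ u ∈ s, HasDerivAt r (r₁ u) u) (hκ : ∀ u ∈ s, r₁ u = κ) {u d : ℝ}
    (hu : u ∈ s) (hd : d ∈ s) : r u * r d * (h u - h d) = D * (u - d) := by
  have hd0 := (hpos d hd).ne'
  have := eq_of_forall_hasDerivAt_zero hs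
    (F := fun t => h t - D * (t - d) / (r t * r d)) (fun t ht => by
      have ht0 := (hpos t ht).ne'
      have h1 := (hh t ht).sub ((((hasDerivAt_id t).sub_const d).const_mul D).div
        ((hr t ht).mul_const (r d)) (mul_ne_zero ht0 hd0))
      convert! h1 using 1
      have h2 := eq_of_deriv_const hs hr hκ ht hd
      rw [hκ t ht]
      simp only [id]
      field_simp
      linear_combination D * h2) hu hd
  have hu0 := (hpos u hu).ne'
  simp only [sub_self, mul_zero, zero_div, sub_zero] at this
  have h3 : h u - h d = D * (u - d) / (r u * r d) := by linear_combination this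
  rw [h3]
  field_simp

theorem exists_left_partner {P₁ P₂ : ℝ → ℝ} {J : Set ℝ} (hJ : IsOpen J)
    (hP₁c : ContinuousOn P₁ J) (hP₂c : ContinuousOn P₂ J) (hP₁ : ∀ u ∈ J, 0 < P₁ u)
    (hP₂ : ∀ u ∈ J, 0 < P₂ u) {a d : ℝ} (had : a < d) (hsub : Icc a d ⊆ J) :
    ∀ᶠ z in 𝓝[>] d, ∃ y ∈ Ico a d, weightedMean P₁ P₂ y z = d := by
  have hd : d ∈ J := hsub (right_mem_Icc.2 had.le)
  have ha : a ∈ J := hsub (left_mem_Icc.2 had.le)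
  have hc : ContinuousAt (fun z => P₁ a * (a - d) + P₂ z * (z - d)) d :=
    ((hP₂c.continuousAt (hJ.mem_nhds hd)).mul (by fun_prop)).const_add _
  have hneg : ∀ᶠ z in 𝓝 d, P₁ a * (a - d) + P₂ z * (z - d) < 0 := by
    refine hc.eventually_lt_const ?_
    simpa using mul_neg_of_pos_of_neg (hP₁ a ha) (sub_neg.2 had)
  filter_upwards [nhdsWithin_le_nhds hneg, nhdsWithin_le_nhds (hJ.mem_nhds hd),
    self_mem_nhdsWithin] with z hz hzJ hdz
  have hdz : d < z := hdz
  have hpos : 0 < P₂ z * (z - d) := mul_pos (hP₂ z hzJ) (sub_pos.2 hdz)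
  obtain ⟨y, hy, hy0⟩ := intermediate_value_Icc had.le
    (f := fun y => P₁ y * (y - d) + P₂ z * (z - d))
    (((hP₁c.mono hsub).mul (by fun_prop)).add continuousOn_const)
    (show (0 : ℝ) ∈ Icc _ _ from ⟨hz.le, by simpa using hpos.le⟩)
  simp only at hy0
  have hyd : y ≠ d := by
    rintro rfl
    simp at hy0
    rcases hy0 with h | h <;> [exact (hP₂ z hzJ).ne' h; linarith]
  refine ⟨y, ⟨hy.1, lt_of_le_of_ne hy.2 hyd⟩, ?_⟩
  have h1 := hP₁ y (hsub hy)
  have h2 := hP₂ z hzJ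
  rw [weightedMean, div_eq_iff (by positivity)]
  linear_combination hy0

/-- If `r` is affine to the left of `d`, the balance equation makes it affine to the right too. -/
theorem eventually_deriv_const_right {h r r₁ r₂ P₁ P₂ : ℝ → ℝ} {D κ : ℝ} {J : Set ℝ}
    (hJ : IsOpen J) (hD : D ≠ 0)
    (hpos : ∀ u ∈ J, 0 < r u) (hh : ∀ u ∈ J, HasDerivAt h (D / r u ^ 2) u)
    (hr : ∀ u ∈ J, HasDerivAt r (r₁ u) u) (hr₁ : ∀ u ∈ J, HasDerivAt r₁ (r₂ u) u)
    (hP₁c : ContinuousOn P₁ J) (hP₂c : ContinuousOn P₂ J) (hP₁ : ∀ u ∈ J, 0 < P₁ u)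
    (hP₂ : ∀ u ∈ J, 0 < P₂ u)
    (H : ∀ x ∈ J, ∀ᶠ z : ℝ × ℝ in 𝓝 (x, x), BalancedAt h r r P₁ P₂ z.1 z.2)
    {a d : ℝ} (had : a < d) (hsub : Icc a d ⊆ J) (hκ : ∀ u ∈ Icc a d, r₁ u = κ) :
    ∀ᶠ u in 𝓝[>] d, r₁ u = κ := by
  have hd : d ∈ J := hsub (right_mem_Icc.2 had.le)
  obtain ⟨ε, hε, hbal⟩ := Metric.eventually_nhds_iff_ball.1 (H d hd)
  set b := max a (d - ε / 2) with hb
  have hbd : b < d := max_lt had (by linarith)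
  have hbsub : Icc b d ⊆ Icc a d := Icc_subset_Icc_left (le_max_left _ _)
  have hT : ∀ᶠ z in 𝓝[>] d, z ∈ J ∧ r z * r d * (h z - h d) = D * (z - d) := by
    filter_upwards [exists_left_partner hJ hP₁c hP₂c hP₁ hP₂ hbd (hbsub.trans hsub),
      nhdsWithin_le_nhds (hJ.mem_nhds hd), nhdsWithin_le_nhds (Metric.ball_mem_nhds d hε)]
      with z ⟨y, hy, hm⟩ hzJ hzε
    refine ⟨hzJ, ?_⟩
    have hyε : y ∈ Metric.ball d ε := by
      rw [Metric.mem_ball, Real.dist_eq, abs_lt]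
      have := le_max_right a (d - ε / 2)
      constructor <;> linarith [hy.1, hy.2]
    have hyz := hbal (y, z) (by rw [← ball_prod_same]; exact ⟨hyε, hzε⟩)
    simp only [BalancedAt, hm] at hyz
    have hyT := mul_mul_sub_eq_of_deriv_const (convex_Icc a d) (fun u hu => hpos u (hsub hu))
      (fun u hu => hh u (hsub hu)) (fun u hu => hr u (hsub hu)) hκ
      (hbsub ⟨hy.1, hy.2.le⟩) (right_mem_Icc.2 had.le)
    have hyd : y - d ≠ 0 := (sub_neg.2 hy.2).ne
    apply mul_left_cancel₀ hyd
    linear_combination (-r d) * hyz + (z - d) * hyT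
  obtain ⟨e, hde, he⟩ := mem_nhdsGT_iff_exists_Ioo_subset.1 hT
  have hde : d < e := hde
  have hz1 : ∀ z ∈ Ioo d e, r z - (z - d) * r₁ z = r d := by
    intro z hz
    have hzJ := (he hz).1
    have hK : HasDerivAt (fun z => r z * r d * (h z - h d) - D * (z - d))
        (r₁ z * r d * (h z - h d) + r z * r d * (D / r z ^ 2) - D * 1) z :=
      (((hr z hzJ).mul_const (r d)).mul ((hh z hzJ).sub_const (h d))).sub
        (((hasDerivAt_id z).sub_const d).const_mul D)
    have h0 := hK.unique ((hasDerivAt_const z (0 : ℝ)).congr_of_eventuallyEq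
      (eventually_of_mem (Ioo_mem_nhds hz.1 hz.2) fun w hw => sub_eq_zero.2 (he hw).2))
    have hz0 := (hpos z hzJ).ne'
    have hzT := (he hz).2
    field_simp at h0
    apply mul_left_cancel₀ hD
    linear_combination (-1) * h0 + r₁ z * hzT
  have hz2 : ∀ z ∈ Ioo d e, r₂ z = 0 := by
    intro z hz
    have hzJ := (he hz).1
    have hK : HasDerivAt (fun z => r z - (z - d) * r₁ z)
        (r₁ z - (1 * r₁ z + (z - d) * r₂ z)) z :=
      (hr z hzJ).sub (((hasDerivAt_id z).sub_const d).mul (hr₁ z hzJ))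
    have h0 := hK.unique ((hasDerivAt_const z (r d)).congr_of_eventuallyEq
      (eventually_of_mem (Ioo_mem_nhds hz.1 hz.2) fun w hw => hz1 w hw))
    have hne : z - d ≠ 0 := (sub_pos.2 hz.1).ne'
    have : (z - d) * r₂ z = 0 := by linear_combination (-1) * h0
    simpa [hne] using this
  have hIoo : Ioo d e ∈ 𝓝[>] d := Ioo_mem_nhdsGT hde
  filter_upwards [hIoo] with z hz
  have hconst : ∀ᶠ w in 𝓝[>] d, r₁ z = r₁ w := by
    filter_upwards [hIoo] with w hw
    exact eq_of_forall_hasDerivAt_zero (convex_Ioo d e)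
      (fun u hu => hz2 u hu ▸ hr₁ u (he hu).1) hz hw
  rw [← hκ d (right_mem_Icc.2 had.le)]
  exact tendsto_nhds_unique (tendsto_const_nhds.congr' hconst)
    ((hr₁ d hd).continuousAt.tendsto.mono_left nhdsWithin_le_nhds)

theorem deriv_const_right {h r r₁ r₂ P₁ P₂ : ℝ → ℝ} {D κ : ℝ} {J : Set ℝ}
    (hJ : IsOpen J) (hJc : J.OrdConnected) (hD : D ≠ 0)
    (hpos : ∀ u ∈ J, 0 < r u) (hh : ∀ u ∈ J, HasDerivAt h (D / r u ^ 2) u)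
    (hr : ∀ u ∈ J, HasDerivAt r (r₁ u) u) (hr₁ : ∀ u ∈ J, HasDerivAt r₁ (r₂ u) u)
    (hP₁c : ContinuousOn P₁ J) (hP₂c : ContinuousOn P₂ J) (hP₁ : ∀ u ∈ J, 0 < P₁ u)
    (hP₂ : ∀ u ∈ J, 0 < P₂ u)
    (H : ∀ x ∈ J, ∀ᶠ z : ℝ × ℝ in 𝓝 (x, x), BalancedAt h r r P₁ P₂ z.1 z.2)
    {x v : ℝ} (hx : x ∈ J) (hv : v ∈ J) (hxv : x ≤ v) (hκ : ∀ᶠ u in 𝓝 x, r₁ u = κ) :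
    r₁ v = κ := by
  obtain ⟨ε, hε, hball⟩ := Metric.eventually_nhds_iff_ball.1 (hκ.and (hJ.mem_nhds hx))
  by_contra hne
  set T := {u | u ∈ Icc x v ∧ r₁ u ≠ κ}
  have hvT : v ∈ T := ⟨right_mem_Icc.2 hxv, hne⟩
  have hbdd : BddBelow T := ⟨x, fun u hu => hu.1.1⟩
  set d := sInf T
  have hxd : x ≤ d := le_csInf ⟨v, hvT⟩ fun u hu => hu.1.1
  have hdv : d ≤ v := csInf_le hbdd hvT
  have hdJ : d ∈ J := hJc.out hx hv ⟨hxd, hdv⟩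
  have ha : x - ε / 2 < d := by linarith
  have hsub : Icc (x - ε / 2) d ⊆ J := hJc.out (hball _ (by
    rw [Metric.mem_ball, Real.dist_eq, abs_lt]; constructor <;> linarith)).2 hdJ
  have hlt : ∀ u ∈ Ico (x - ε / 2) d, r₁ u = κ := by
    intro u hu
    rcases lt_or_ge u x with hux | hux
    · refine (hball u ?_).1
      rw [Metric.mem_ball, Real.dist_eq, abs_lt]
      constructor <;> linarith [hu.1]
    · by_contra hcon
      exact absurd (csInf_le hbdd ⟨⟨hux, hu.2.le.trans hdv⟩, hcon⟩) (not_le.2 hu.2)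
  have hd : r₁ d = κ :=
    tendsto_nhds_unique ((hr₁ d hdJ).continuousAt.tendsto.mono_left nhdsWithin_le_nhds)
      (tendsto_const_nhds.congr' (eventually_of_mem (Ico_mem_nhdsLT ha) fun u hu => (hlt u hu).symm))
  have hle : ∀ u ∈ Icc (x - ε / 2) d, r₁ u = κ := by
    intro u hu
    rcases hu.2.lt_or_eq with h | rfl
    exacts [hlt u ⟨hu.1, h⟩, hd]
  have hev := eventually_deriv_const_right hJ hD hpos hh hr hr₁ hP₁c hP₂c hP₁ hP₂ H ha hsub hle
  obtain ⟨e, hde, he⟩ := mem_nhdsGT_iff_exists_Ioo_subset.1 hev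
  have hde : d < e := hde
  obtain ⟨u, huT, hue⟩ := exists_lt_of_csInf_lt ⟨v, hvT⟩ hde
  rcases (csInf_le hbdd huT).lt_or_eq with h | h
  · exact huT.2 (he ⟨h, hue⟩)
  · exact huT.2 (h ▸ hd)

theorem weightedMean_neg (P₁ P₂ : ℝ → ℝ) (y z : ℝ) :
    weightedMean (fun u => P₁ (-u)) (fun u => P₂ (-u)) y z =
      -weightedMean P₁ P₂ (-y) (-z) := by
  simp only [weightedMean]
  ring

theorem BalancedAt.neg {h R₁ R₂ P₁ P₂ : ℝ → ℝ} {y z : ℝ}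
    (H : BalancedAt h R₁ R₂ P₁ P₂ (-y) (-z)) :
    BalancedAt (fun u => h (-u)) (fun u => R₁ (-u)) (fun u => R₂ (-u)) (fun u => P₁ (-u))
      (fun u => P₂ (-u)) y z := by
  simp only [BalancedAt, weightedMean_neg, neg_neg] at H ⊢
  linear_combination (-1) * H

theorem deriv_const_of_balanced {h r r₁ r₂ P₁ P₂ : ℝ → ℝ} {D κ : ℝ} {J : Set ℝ}
    (hJ : IsOpen J) (hJc : J.OrdConnected) (hD : D ≠ 0)
    (hpos : ∀ u ∈ J, 0 < r u) (hh : ∀ u ∈ J, HasDerivAt h (D / r u ^ 2) u)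
    (hr : ∀ u ∈ J, HasDerivAt r (r₁ u) u) (hr₁ : ∀ u ∈ J, HasDerivAt r₁ (r₂ u) u)
    (hP₁c : ContinuousOn P₁ J) (hP₂c : ContinuousOn P₂ J) (hP₁ : ∀ u ∈ J, 0 < P₁ u)
    (hP₂ : ∀ u ∈ J, 0 < P₂ u)
    (H : ∀ x ∈ J, ∀ᶠ z : ℝ × ℝ in 𝓝 (x, x), BalancedAt h r r P₁ P₂ z.1 z.2)
    {x v : ℝ} (hx : x ∈ J) (hv : v ∈ J) (hκ : ∀ᶠ u in 𝓝 x, r₁ u = κ) :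
    r₁ v = κ := by
  rcases le_total x v with hxv | hvx
  · exact deriv_const_right hJ hJc hD hpos hh hr hr₁ hP₁c hP₂c hP₁ hP₂ H hx hv hxv hκ
  · have hmaps : MapsTo (fun u : ℝ => -u) (Neg.neg ⁻¹' J) J := fun u hu => hu
    have := deriv_const_right (h := fun u => h (-u)) (r := fun u => r (-u))
      (r₁ := fun u => -r₁ (-u)) (r₂ := fun u => r₂ (-u)) (P₁ := fun u => P₁ (-u))
      (P₂ := fun u => P₂ (-u)) (D := -D) (κ := -κ) (J := Neg.neg ⁻¹' J) (x := -x) (v := -v)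
      (hJ.preimage continuous_neg)
      ⟨fun a ha b hb c hc => hJc.out hb ha ⟨neg_le_neg hc.2, neg_le_neg hc.1⟩⟩ (neg_ne_zero.2 hD)
      (fun u hu => hpos _ hu)
      (fun u hu => by
        convert! (hh (-u) hu).comp u (hasDerivAt_neg u) using 1
        ring)
      (fun u hu => by
        convert! (hr (-u) hu).comp u (hasDerivAt_neg u) using 1
        ring)
      (fun u hu => by
        convert! ((hr₁ (-u) hu).comp u (hasDerivAt_neg u)).neg using 1
        ring)
      (hP₁c.comp continuous_neg.continuousOn hmaps) (hP₂c.comp continuous_neg.continuousOn hmaps)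
      (fun u hu => hP₁ _ hu) (fun u hu => hP₂ _ hu)
      (fun u hu => by
        have hcont : Tendsto (fun z : ℝ × ℝ => (-z.1, -z.2)) (𝓝 (u, u)) (𝓝 (-u, -u)) :=
          Continuous.tendsto (by fun_prop) _
        exact (hcont.eventually (H (-u) hu)).mono fun z hz => BalancedAt.neg hz)
      (by simpa using hx) (by simpa using hv) (neg_le_neg hvx)
      (by
        have hcont : Tendsto (fun u : ℝ => -u) (𝓝 (-x)) (𝓝 x) :=
          Continuous.tendsto' (by fun_prop) _ _ (neg_neg x)
        exact (hcont.eventually hκ).mono fun u hu => congrArg Neg.neg hu)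
    simpa using this

theorem exists_moebius_of_balanced {h h₁ h₂ h₃ R₁ R₂ P₁ P₂ : ℝ → ℝ} {J : Set ℝ}
    (hJ : IsOpen J) (hJc : J.OrdConnected)
    (hh : ∀ u ∈ J, HasDerivAt h (h₁ u) u) (hh₁ : ∀ u ∈ J, HasDerivAt h₁ (h₂ u) u)
    (hh₂ : ∀ u ∈ J, HasDerivAt h₂ (h₃ u) u) (hne : ∀ u ∈ J, h₁ u ≠ 0)
    (hR₁ : ∀ u ∈ J, 0 < R₁ u)
    (hP₁c : ContinuousOn P₁ J) (hP₂c : ContinuousOn P₂ J) (hP₁ : ∀ u ∈ J, 0 < P₁ u)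
    (hP₂ : ∀ u ∈ J, 0 < P₂ u)
    (H : ∀ x ∈ J, ∀ᶠ z : ℝ × ℝ in 𝓝 (x, x), BalancedAt h R₁ R₂ P₁ P₂ z.1 z.2)
    (hP : ∃ x ∈ J, P₁ x ≠ P₂ x) :
    ∃ a b c d : ℝ, a * d ≠ b * c ∧ ∀ u ∈ J,
      R₁ u = c * u + d ∧ R₂ u = c * u + d ∧ h u = (a * u + b) / (c * u + d) := by
  obtain ⟨x₀, hx₀, hPx₀⟩ := hP
  have hconv : Convex ℝ J := hJc.convex
  have hmem : ∀ {x}, x ∈ J → ∀ᶠ u in 𝓝 x, u ∈ J := fun hx => hJ.mem_nhds hx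
  have hTaylor : ∀ x ∈ J, ∃ E : ℝ → ℝ, Tendsto E (𝓝 0) (𝓝 0) ∧ ∀ t, h (x + t) =
      h x + h₁ x * t + h₂ x / 2 * t ^ 2 + h₃ x / 6 * t ^ 3 + E t * t ^ 3 := fun x hx =>
    exists_cubic_remainder ((hmem hx).mono hh) ((hmem hx).mono hh₁) (hh₂ x hx)
  have hswap : ∀ x ∈ J, ∀ᶠ z : ℝ × ℝ in 𝓝 (x, x), BalancedAt h R₂ R₁ P₂ P₁ z.1 z.2 := by
    intro x hx
    have hs : Tendsto (Prod.swap : ℝ × ℝ → ℝ × ℝ) (𝓝 (x, x)) (𝓝 (x, x)) :=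
      continuous_swap.tendsto _
    exact (hs.eventually (H x hx)).mono fun z hz => hz.swap
  have hslope : ∀ {R R' P P' : ℝ → ℝ}, ContinuousOn P' J → (∀ u ∈ J, 0 < P u) →
      (∀ u ∈ J, 0 < P' u) →
      (∀ x ∈ J, ∀ᶠ z : ℝ × ℝ in 𝓝 (x, x), BalancedAt h R R' P P' z.1 z.2) → ∀ x ∈ J,
      Tendsto (fun t => t⁻¹ * (R' (x + t) - R x)) (𝓝[≠] 0)
        (𝓝 (-(h₂ x / (2 * h₁ x)) * R x)) := by
    intro R R' P P' hc hP hP' HB x hx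
    obtain ⟨E, hE0, hE⟩ := hTaylor x hx
    exact tendsto_slope_of_balanced hE0 hE (hne x hx) (hP x hx) (hP' x hx)
      (hc.continuousAt (hJ.mem_nhds hx)) (HB x hx)
  have hlim : ∀ {F : ℝ → ℝ} {x c l : ℝ},
      Tendsto (fun t => t⁻¹ * (F (x + t) - c)) (𝓝[≠] 0) (𝓝 l) → Tendsto F (𝓝[≠] x) (𝓝 c) := by
    intro F x c l hF
    have hid : Tendsto (fun t : ℝ => t) (𝓝[≠] 0) (𝓝 0) := nhdsWithin_le_nhds
    have h1 : Tendsto (fun t => c + t * (t⁻¹ * (F (x + t) - c))) (𝓝[≠] 0) (𝓝 c) := by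
      simpa using (hid.mul hF).const_add c
    have h2 : Tendsto (fun u => u - x) (𝓝[≠] x) (𝓝[≠] 0) := by
      refine tendsto_nhdsWithin_of_tendsto_nhds_of_eventually_within _
        (((continuous_sub_right x).tendsto' _ _ (sub_self x)).mono_left nhdsWithin_le_nhds) ?_
      filter_upwards [self_mem_nhdsWithin] with u hu using sub_ne_zero.2 hu
    refine (h1.comp h2).congr' ?_
    filter_upwards [self_mem_nhdsWithin] with u hu
    have hu : u - x ≠ 0 := sub_ne_zero.2 hu
    simp only [Function.comp, add_sub_cancel]
    field_simp
    ring
  have hRR : EqOn R₂ R₁ J := eqOn_of_forall_tendsto_punctured hJ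
    (fun x hx => hlim (hslope hP₂c hP₁ hP₂ H x hx))
    (fun x hx => hlim (hslope hP₁c hP₂ hP₁ hswap x hx))
  have hr : ∀ u ∈ J, HasDerivAt R₁ (-(h₂ u / (2 * h₁ u)) * R₁ u) u := by
    intro u hu
    rw [hasDerivAt_iff_tendsto_slope_zero]
    have := hslope hP₁c hP₂ hP₁ hswap u hu
    rw [hRR hu] at this
    simpa using this
  have hbal : ∀ x ∈ J, ∀ᶠ z : ℝ × ℝ in 𝓝 (x, x), BalancedAt h R₁ R₁ P₁ P₂ z.1 z.2 := by
    intro x hx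
    filter_upwards [H x hx, (hJ.prod hJ).mem_nhds (⟨hx, hx⟩ : (x, x) ∈ J ×ˢ J)] with z hz hzJ
    rw [BalancedAt, hRR hzJ.2] at hz
    exact hz
  set r₁ : ℝ → ℝ := fun u => -(h₂ u / (2 * h₁ u)) * R₁ u with hr₁def
  set r₂ : ℝ → ℝ := fun u => -(3 * (h₂ u * r₁ u) + h₃ u * R₁ u) / (2 * h₁ u) with hr₂def
  have hr₁eq : ∀ u ∈ J, 2 * (r₁ u * h₁ u) + h₂ u * R₁ u = 0 := by
    intro u hu
    have := hne u hu
    simp only [hr₁def]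
    field_simp
    ring
  have hr₂eq : ∀ u ∈ J, 2 * (r₂ u * h₁ u) + 3 * (h₂ u * r₁ u) + h₃ u * R₁ u = 0 := by
    intro u hu
    have := hne u hu
    simp only [hr₂def]
    field_simp
    ring
  have hr₁ : ∀ u ∈ J, HasDerivAt r₁ (r₂ u) u := by
    intro u hu
    have hu0 := hne u hu
    have hd := (((hh₂ u hu).div ((hh₁ u hu).const_mul 2) (mul_ne_zero two_ne_zero hu0)).neg).mul
      (hr u hu)
    convert! hd using 1
    have h1 := hr₁eq u hu
    have h1' : r₁ u = -(h₂ u / (2 * h₁ u)) * R₁ u := rfl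
    simp only [hr₂def, Pi.neg_apply, Pi.div_apply]
    rw [h1']
    field_simp
    ring
  have hDconst : ∀ u ∈ J, R₁ u ^ 2 * h₁ u = R₁ x₀ ^ 2 * h₁ x₀ := by
    intro u hu
    refine eq_of_forall_hasDerivAt_zero hconv (F := fun u => R₁ u ^ 2 * h₁ u)
      (fun t ht => ?_) hu hx₀
    convert! ((hr t ht).pow 2).mul (hh₁ t ht) using 1
    have h1 := hr₁eq t ht
    simp only [Nat.cast_ofNat, Nat.add_one_sub_one, pow_one, Pi.pow_apply]
    linear_combination (-R₁ t) * h1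
  set D := R₁ x₀ ^ 2 * h₁ x₀ with hDdef
  have hx₀r := hR₁ x₀ hx₀
  have hD : D ≠ 0 := mul_ne_zero (by positivity) (hne x₀ hx₀)
  have hh' : ∀ u ∈ J, HasDerivAt h (D / R₁ u ^ 2) u := by
    intro u hu
    have hu0 := hR₁ u hu
    rw [← hDconst u hu, mul_div_cancel_left₀ _ (by positivity)]
    exact hh u hu
  have hr₂zero : ∀ u ∈ J, P₁ u ≠ P₂ u → r₂ u = 0 := by
    intro u hu hPu
    obtain ⟨E, hE0, hE⟩ := hTaylor u hu
    obtain ⟨ρ, hρ0, hρ⟩ := exists_quadratic_remainder ((hmem hu).mono hr) (hr₁ u hu)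
    exact second_deriv_mul_eq_zero_of_balanced hE0 hE hρ0 hρ (hr₁eq u hu) (hr₂eq u hu)
      (hne u hu) (hP₁ u hu) (hP₂ u hu) (hP₂c.continuousAt (hJ.mem_nhds hu)) hPu (hbal u hu)
  have hκloc : ∀ᶠ u in 𝓝 x₀, r₁ u = r₁ x₀ := by
    have hev : ∀ᶠ u in 𝓝 x₀, u ∈ J ∧ P₁ u ≠ P₂ u :=
      (hmem hx₀).and ((hP₁c.continuousAt (hJ.mem_nhds hx₀)).ne_iff_eventually_ne
        (hP₂c.continuousAt (hJ.mem_nhds hx₀)) |>.1 hPx₀)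
    obtain ⟨ε, hε, hball⟩ := Metric.eventually_nhds_iff_ball.1 hev
    filter_upwards [Metric.ball_mem_nhds x₀ hε] with u hu
    exact eq_of_forall_hasDerivAt_zero (convex_ball x₀ ε)
      (fun t ht => hr₂zero t (hball t ht).1 (hball t ht).2 ▸ hr₁ t (hball t ht).1) hu
      (Metric.mem_ball_self hε)
  have hκ : ∀ u ∈ J, r₁ u = r₁ x₀ := fun u hu =>
    deriv_const_of_balanced hJ hJc hD hR₁ hh' hr hr₁ hP₁c hP₂c hP₁ hP₂ hbal hx₀ hu hκloc
  have hlin : ∀ u ∈ J, R₁ u = r₁ x₀ * u + (R₁ x₀ - r₁ x₀ * x₀) := by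
    intro u hu
    have := eq_of_deriv_const hconv hr hκ hu hx₀
    linear_combination this
  refine ⟨h x₀ * r₁ x₀ + D / R₁ x₀, h x₀ * (R₁ x₀ - r₁ x₀ * x₀) - D / R₁ x₀ * x₀, r₁ x₀,
    R₁ x₀ - r₁ x₀ * x₀, ?_, fun u hu => ⟨hlin u hu, (hRR hu).trans (hlin u hu), ?_⟩⟩
  · rw [← sub_ne_zero]
    convert hD using 1
    field_simp
    ring
  · have hu0 := hR₁ u hu
    have hT := mul_mul_sub_eq_of_deriv_const hconv hR₁ hh' hr hκ hu hx₀
    rw [← hlin u hu, eq_div_iff hu0.ne']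
    apply mul_left_cancel₀ hx₀r.ne'
    have hl := hlin u hu
    have hD' : D / R₁ x₀ * R₁ x₀ = D := div_mul_cancel₀ _ hx₀r.ne'
    linear_combination hT + R₁ x₀ * h x₀ * hl - (u - x₀) * hD'

theorem convex_weighted_mem {s : Set ℝ} (hs : Convex ℝ s) {y z p q : ℝ} (hy : y ∈ s) (hz : z ∈ s)
    (hp : 0 < p) (hq : 0 < q) : (p * y + q * z) / (p + q) ∈ s := by
  convert hs hy hz (div_nonneg hp.le (add_pos hp hq).le) (div_nonneg hq.le (add_pos hp hq).le)
    (by field_simp) using 1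
  simp only [smul_eq_mul]
  field_simp

theorem image_nhds_facts {I : Set ℝ} (hI : IsOpen I) {f φ : ℝ → ℝ}
    (hf : DifferentiableOn ℝ f I) (hf2 : DifferentiableOn ℝ (deriv f) I)
    (hf' : ∀ x ∈ I, deriv f x ≠ 0) (hφ : ∀ x ∈ I, φ (f x) = x) :
    IsOpen (f '' I) ∧ ∀ x ∈ I, HasDerivAt φ (deriv f x)⁻¹ (f x) := by
  have hmap : ∀ x ∈ I, map f (𝓝 x) = 𝓝 (f x) := fun x hx =>
    (hasStrictDerivAt_of_hasDerivAt_of_continuousAt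
      (eventually_of_mem (hI.mem_nhds hx) fun y hy =>
        (hf.differentiableAt (hI.mem_nhds hy)).hasDerivAt)
      (hf2.differentiableAt (hI.mem_nhds hx)).continuousAt).map_nhds_eq (hf' x hx)
  have hopen : IsOpen (f '' I) := by
    rw [isOpen_iff_mem_nhds]
    rintro _ ⟨x, hx, rfl⟩
    rw [← hmap x hx]
    exact image_mem_map (hI.mem_nhds hx)
  refine ⟨hopen, fun x hx => ?_⟩
  have hc : ContinuousAt φ (f x) := by
    rw [ContinuousAt, ← hmap x hx, tendsto_map'_iff, hφ x hx]
    exact tendsto_id.congr' (eventually_of_mem (hI.mem_nhds hx) fun y hy => (hφ y hy).symm)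
  refine HasDerivAt.of_local_left_inverse (f := f) hc ?_ (hf' x hx) ?_
  · rw [hφ x hx]
    exact (hf.differentiableAt (hI.mem_nhds hx)).hasDerivAt
  · filter_upwards [hopen.mem_nhds (mem_image_of_mem f hx)] with _ ⟨y, hy, hyu⟩
    rw [← hyu, hφ y hy]

/-- In the coordinate `u = f x`, equality of the two means near the diagonal becomes the balance
equation. -/
theorem balancedAt_of_bmean2_eq {I : Set ℝ} {f φ g ψ p₁ p₂ q₁ q₂ : ℝ → ℝ}
    (hfI : Convex ℝ (f '' I)) (hgI : Convex ℝ (g '' I))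
    (hφ : ∀ x ∈ I, φ (f x) = x) (hψ : ∀ x ∈ I, ψ (g x) = x)
    (hp₁ : ∀ x ∈ I, 0 < p₁ x) (hp₂ : ∀ x ∈ I, 0 < p₂ x)
    (hq₁ : ∀ x ∈ I, 0 < q₁ x) (hq₂ : ∀ x ∈ I, 0 < q₂ x)
    {x y : ℝ} (hx : x ∈ I) (hy : y ∈ I) (h : bmean2 f φ p₁ p₂ x y = bmean2 g ψ q₁ q₂ x y) :
    BalancedAt (g ∘ φ) (fun u => q₁ (φ u) / p₁ (φ u)) (fun u => q₂ (φ u) / p₂ (φ u))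
      (p₁ ∘ φ) (p₂ ∘ φ) (f x) (f y) := by
  obtain ⟨m, hm, hfm⟩ := convex_weighted_mem hfI (mem_image_of_mem f hx) (mem_image_of_mem f hy)
    (hp₁ x hx) (hp₂ y hy)
  obtain ⟨n, hn, hgn⟩ := convex_weighted_mem hgI (mem_image_of_mem g hx) (mem_image_of_mem g hy)
    (hq₁ x hx) (hq₂ y hy)
  rw [bmean2, bmean2, ← hfm, ← hgn, hφ m hm, hψ n hn] at h
  subst h
  have hw : weightedMean (p₁ ∘ φ) (p₂ ∘ φ) (f x) (f y) = f m := by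
    rw [hfm, weightedMean]
    simp only [Function.comp, hφ x hx, hφ y hy]
  have h1 := hp₁ x hx
  have h2 := hp₂ y hy
  have h3 := hq₁ x hx
  have h4 := hq₂ y hy
  rw [BalancedAt, hw]
  simp only [Function.comp, hφ x hx, hφ y hy, hφ m hm]
  rw [eq_div_iff (by positivity)] at hfm hgn
  rw [div_mul_eq_mul_div, div_mul_eq_mul_div, div_mul_eq_mul_div, div_mul_eq_mul_div,
    div_eq_div_iff h1.ne' h2.ne']
  linear_combination (-(q₁ x * (g x - g m))) * hfm + p₁ x * (f x - f m) * hgn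

theorem bmean2_eq_of_moebius {I : Set ℝ} {f φ g ψ p₁ p₂ q₁ q₂ : ℝ → ℝ} {a b c d : ℝ}
    (hfI : Convex ℝ (f '' I)) (hφ : ∀ x ∈ I, φ (f x) = x) (hψ : ∀ x ∈ I, ψ (g x) = x)
    (hp₁ : ∀ x ∈ I, 0 < p₁ x) (hp₂ : ∀ x ∈ I, 0 < p₂ x) (hq₁ : ∀ x ∈ I, 0 < q₁ x)
    (hg : ∀ x ∈ I, g x = (a * f x + b) / (c * f x + d))
    (hqp₁ : ∀ x ∈ I, q₁ x = (c * f x + d) * p₁ x) (hqp₂ : ∀ x ∈ I, q₂ x = (c * f x + d) * p₂ x)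
    {x y : ℝ} (hx : x ∈ I) (hy : y ∈ I) : bmean2 f φ p₁ p₂ x y = bmean2 g ψ q₁ q₂ x y := by
  have hpos : ∀ t ∈ I, 0 < c * f t + d := fun t ht =>
    pos_of_mul_pos_left (hqp₁ t ht ▸ hq₁ t ht) (hp₁ t ht).le
  obtain ⟨m, hm, hfm⟩ := convex_weighted_mem hfI (mem_image_of_mem f hx) (mem_image_of_mem f hy)
    (hp₁ x hx) (hp₂ y hy)
  have h1 := hp₁ x hx
  have h2 := hp₂ y hy
  have hx0 := hpos x hx
  have hy0 := hpos y hy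
  have hm0 := hpos m hm
  have hgm : (q₁ x * g x + q₂ y * g y) / (q₁ x + q₂ y) = g m := by
    have hxg : q₁ x * g x = p₁ x * (a * f x + b) := by
      rw [hqp₁ x hx, hg x hx]; field_simp
    have hyg : q₂ y * g y = p₂ y * (a * f y + b) := by
      rw [hqp₂ y hy, hg y hy]; field_simp
    rw [hxg, hyg, hg m hm, hqp₁ x hx, hqp₂ y hy, div_eq_div_iff (by positivity) hm0.ne']
    rw [eq_div_iff (by positivity)] at hfm
    linear_combination (b * c - a * d) * hfm
  rw [bmean2, bmean2, hgm, ← hfm, hφ m hm, hψ m hm]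

theorem exists_moebius_of_bmean2_eq {I : Set ℝ} (hI : IsOpen I) (hIc : I.OrdConnected)
    {f φ g ψ p₁ p₂ q₁ q₂ : ℝ → ℝ}
    (hfd : DifferentiableOn ℝ f I) (hfd2 : DifferentiableOn ℝ (deriv f) I)
    (hfd3 : DifferentiableOn ℝ (deriv (deriv f)) I)
    (hgd : DifferentiableOn ℝ g I) (hgd2 : DifferentiableOn ℝ (deriv g) I)
    (hgd3 : DifferentiableOn ℝ (deriv (deriv g)) I)
    (hf' : ∀ x ∈ I, deriv f x ≠ 0) (hg' : ∀ x ∈ I, deriv g x ≠ 0)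
    (hφ : ∀ x ∈ I, φ (f x) = x) (hψ : ∀ x ∈ I, ψ (g x) = x)
    (hp₁ : ∀ x ∈ I, 0 < p₁ x) (hp₂ : ∀ x ∈ I, 0 < p₂ x)
    (hq₁ : ∀ x ∈ I, 0 < q₁ x) (hq₂ : ∀ x ∈ I, 0 < q₂ x)
    (hp₁c : ContinuousOn p₁ I) (hp₂c : ContinuousOn p₂ I) (hpne : ∃ x ∈ I, p₁ x ≠ p₂ x)
    {U : Set (ℝ × ℝ)} (hU : IsOpen U) (hdiag : ∀ x ∈ I, (x, x) ∈ U)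
    (hmean : ∀ z ∈ U, z ∈ I ×ˢ I → bmean2 f φ p₁ p₂ z.1 z.2 = bmean2 g ψ q₁ q₂ z.1 z.2) :
    ∃ a b c d : ℝ, a * d ≠ b * c ∧
      (∀ x ∈ I, g x = (a * f x + b) / (c * f x + d)) ∧
      (∀ x ∈ I, q₁ x = (c * f x + d) * p₁ x) ∧
      (∀ x ∈ I, q₂ x = (c * f x + d) * p₂ x) := by
  obtain ⟨hJ, hφd⟩ := image_nhds_facts hI hfd hfd2 hf' hφ
  have hJc : (f '' I).OrdConnected :=
    (hIc.isPreconnected.image f hfd.continuousOn).ordConnected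
  have hgc : (g '' I).OrdConnected :=
    (hIc.isPreconnected.image g hgd.continuousOn).ordConnected
  have hat : ∀ {k : ℝ → ℝ}, DifferentiableOn ℝ k I → ∀ x ∈ I, HasDerivAt k (deriv k x) x :=
    fun hk x hx => (hk.differentiableAt (hI.mem_nhds hx)).hasDerivAt
  have hcomp : ∀ {k k' : ℝ → ℝ}, (∀ x ∈ I, HasDerivAt k (k' x) x) →
      ∀ u ∈ f '' I, HasDerivAt (k ∘ φ) (((fun x => k' x / deriv f x) ∘ φ) u) u := by
    rintro k k' hk _ ⟨x, hx, rfl⟩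
    simp only [Function.comp, hφ x hx]
    exact HasDerivAt.comp (f x) (by rw [hφ x hx]; exact hk x hx) (hφd x hx)
  have hφc : ∀ x ∈ I, ContinuousAt φ (f x) := fun x hx => (hφd x hx).continuousAt
  have hφmaps : MapsTo φ (f '' I) I := by
    rintro _ ⟨x, hx, rfl⟩
    rwa [hφ x hx]
  have hφcont : ContinuousOn φ (f '' I) := by
    rintro _ ⟨x, hx, rfl⟩
    exact (hφc x hx).continuousWithinAt
  have hk₁ : ∀ x ∈ I, HasDerivAt (fun x => deriv g x / deriv f x)
      ((deriv (deriv g) x * deriv f x - deriv g x * deriv (deriv f) x) / deriv f x ^ 2) x :=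
    fun x hx => (hat hgd2 x hx).div (hat hfd2 x hx) (hf' x hx)
  have hk₂ : DifferentiableOn ℝ (fun x => (deriv (deriv g) x * deriv f x -
      deriv g x * deriv (deriv f) x) / deriv f x ^ 2 / deriv f x) I :=
    (((hgd3.mul hfd2).sub (hgd2.mul hfd3)).div (hfd2.pow 2)
      fun x hx => pow_ne_zero 2 (hf' x hx)).div hfd2 hf'
  obtain ⟨a, b, c, d, hdet, habcd⟩ := exists_moebius_of_balanced hJ hJc
    (h := g ∘ φ) (R₁ := fun u => q₁ (φ u) / p₁ (φ u)) (R₂ := fun u => q₂ (φ u) / p₂ (φ u))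
    (P₁ := p₁ ∘ φ) (P₂ := p₂ ∘ φ) (hcomp (hat hgd)) (hcomp hk₁) (hcomp (hat hk₂))
    (fun u hu => div_ne_zero (hg' _ (hφmaps hu)) (hf' _ (hφmaps hu)))
    (fun u hu => div_pos (hq₁ _ (hφmaps hu)) (hp₁ _ (hφmaps hu)))
    (hp₁c.comp hφcont hφmaps) (hp₂c.comp hφcont hφmaps)
    (fun u hu => hp₁ _ (hφmaps hu)) (fun u hu => hp₂ _ (hφmaps hu))
    (by
      rintro _ ⟨x, hx, rfl⟩
      have hpair : ContinuousAt (fun z : ℝ × ℝ => (φ z.1, φ z.2)) (f x, f x) :=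
        ContinuousAt.prodMk
          (ContinuousAt.comp (f := Prod.fst) (hφc x hx) continuousAt_fst)
          (ContinuousAt.comp (f := Prod.snd) (hφc x hx) continuousAt_snd)
      have hUx : U ∈ 𝓝 (φ (f x), φ (f x)) := by
        rw [hφ x hx]
        exact hU.mem_nhds (hdiag x hx)
      filter_upwards [hpair.eventually_mem hUx,
        (hJ.prod hJ).mem_nhds ⟨mem_image_of_mem f hx, mem_image_of_mem f hx⟩]
        with ⟨_, _⟩ hzU ⟨⟨y, hy, hyu⟩, ⟨z, hz, hzu⟩⟩
      simp only at hyu hzu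
      subst hyu hzu
      simp only [hφ y hy, hφ z hz] at hzU
      exact balancedAt_of_bmean2_eq hJc.convex hgc.convex hφ hψ hp₁ hp₂ hq₁ hq₂ hy hz
        (hmean _ hzU ⟨hy, hz⟩))
    (by
      obtain ⟨x, hx, hne⟩ := hpne
      exact ⟨f x, mem_image_of_mem f hx, by simpa [hφ x hx] using hne⟩)
  have hval := fun x hx => habcd (f x) (mem_image_of_mem f hx)
  refine ⟨a, b, c, d, hdet, fun x hx => ?_, fun x hx => ?_, fun x hx => ?_⟩
  · simpa [hφ x hx] using (hval x hx).2.2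
  · have := (hval x hx).1
    simp only [hφ x hx] at this
    rw [← this, div_mul_cancel₀ _ (hp₁ x hx).ne']
  · have := (hval x hx).2.1
    simp only [hφ x hx] at this
    rw [← this, div_mul_cancel₀ _ (hp₂ x hx).ne']

end

/-- Theorem eq2 (two-variable nonsymmetric case): under regularity condition
(a) or (b) on the weights and `p₁ ≠ p₂` on `I`, the following are equivalent:
(i) equality of the means on `I²`, (ii) equality on an open subset of `I²`
containing the diagonal, and (iv) the canonical relations
`g = (af+b)/(cf+d)`, `q₁ = (cf+d)p₁`, `q₂ = (cf+d)p₂` with `ad ≠ bc`. -/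
theorem stmt_19 (I : Set ℝ) (hIopen : IsOpen I) (hIne : I.Nonempty)
    (hIconn : I.OrdConnected) (f g : ℝ → ℝ)
    (hfd : DifferentiableOn ℝ f I) (hfd2 : DifferentiableOn ℝ (deriv f) I)
    (hfd3 : DifferentiableOn ℝ (deriv (deriv f)) I)
    (hgd : DifferentiableOn ℝ g I) (hgd2 : DifferentiableOn ℝ (deriv g) I)
    (hgd3 : DifferentiableOn ℝ (deriv (deriv g)) I)
    (hf' : ∀ x ∈ I, deriv f x ≠ 0) (hg' : ∀ x ∈ I, deriv g x ≠ 0)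
    (hf : StrictMonoOn f I ∨ StrictAntiOn f I)
    (hg : StrictMonoOn g I ∨ StrictAntiOn g I)
    (finvf : ℝ → ℝ)
    (hfmaps : Set.MapsTo finvf (convexHull ℝ (f '' I)) I)
    (hfmono : MonotoneOn finvf (convexHull ℝ (f '' I)) ∨
      AntitoneOn finvf (convexHull ℝ (f '' I)))
    (hfleft : ∀ x ∈ I, finvf (f x) = x)
    (finvg : ℝ → ℝ)
    (hgmaps : Set.MapsTo finvg (convexHull ℝ (g '' I)) I)
    (hgmono : MonotoneOn finvg (convexHull ℝ (g '' I)) ∨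
      AntitoneOn finvg (convexHull ℝ (g '' I)))
    (hgleft : ∀ x ∈ I, finvg (g x) = x)
    (p₁ p₂ q₁ q₂ : ℝ → ℝ)
    (hp₁ : ∀ x ∈ I, 0 < p₁ x) (hp₂ : ∀ x ∈ I, 0 < p₂ x)
    (hq₁ : ∀ x ∈ I, 0 < q₁ x) (hq₂ : ∀ x ∈ I, 0 < q₂ x)
    (hpne : ∃ x ∈ I, p₁ x ≠ p₂ x)
    (hreg :
      ((ContDiffOn ℝ 2 p₁ I ∧ ContinuousOn p₂ I) ∨
        ((DifferentiableOn ℝ p₁ I ∧ DifferentiableOn ℝ (deriv p₁) I) ∧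
          DifferentiableOn ℝ p₂ I)) ∨
      ((ContDiffOn ℝ 2 p₂ I ∧ ContinuousOn p₁ I) ∨
        ((DifferentiableOn ℝ p₂ I ∧ DifferentiableOn ℝ (deriv p₂) I) ∧
          DifferentiableOn ℝ p₁ I))) :
    ((∀ x₁ ∈ I, ∀ x₂ ∈ I,
        bmean2 f finvf p₁ p₂ x₁ x₂ = bmean2 g finvg q₁ q₂ x₁ x₂) ↔
      (∃ a b c d : ℝ, a * d ≠ b * c ∧
        (∀ x ∈ I, g x = (a * f x + b) / (c * f x + d)) ∧
        (∀ x ∈ I, q₁ x = (c * f x + d) * p₁ x) ∧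
        (∀ x ∈ I, q₂ x = (c * f x + d) * p₂ x))) ∧
    ((∃ U : Set (ℝ × ℝ), IsOpen U ∧ U ⊆ I ×ˢ I ∧
        (∀ x ∈ I, (x, x) ∈ U) ∧
        ∀ z ∈ U, bmean2 f finvf p₁ p₂ z.1 z.2 = bmean2 g finvg q₁ q₂ z.1 z.2) ↔
      (∃ a b c d : ℝ, a * d ≠ b * c ∧
        (∀ x ∈ I, g x = (a * f x + b) / (c * f x + d)) ∧
        (∀ x ∈ I, q₁ x = (c * f x + d) * p₁ x) ∧
        (∀ x ∈ I, q₂ x = (c * f x + d) * p₂ x))) := by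
  have hcont : ContinuousOn p₁ I ∧ ContinuousOn p₂ I := by
    rcases hreg with (⟨h1, h2⟩ | ⟨⟨h1, -⟩, h2⟩) | (⟨h1, h2⟩ | ⟨⟨h1, -⟩, h2⟩)
    exacts [⟨h1.continuousOn, h2⟩, ⟨h1.continuousOn, h2.continuousOn⟩, ⟨h2, h1.continuousOn⟩,
      ⟨h2.continuousOn, h1.continuousOn⟩]
  have hfI : Convex ℝ (f '' I) :=
    (hIconn.isPreconnected.image f hfd.continuousOn).ordConnected.convex
  have hback : (∃ a b c d : ℝ, a * d ≠ b * c ∧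
        (∀ x ∈ I, g x = (a * f x + b) / (c * f x + d)) ∧
        (∀ x ∈ I, q₁ x = (c * f x + d) * p₁ x) ∧
        (∀ x ∈ I, q₂ x = (c * f x + d) * p₂ x)) → ∀ x₁ ∈ I, ∀ x₂ ∈ I,
        bmean2 f finvf p₁ p₂ x₁ x₂ = bmean2 g finvg q₁ q₂ x₁ x₂ := by
    rintro ⟨a, b, c, d, -, h1, h2, h3⟩ x₁ hx₁ x₂ hx₂
    exact bmean2_eq_of_moebius hfI hfleft hgleft hp₁ hp₂ hq₁ h1 h2 h3 hx₁ hx₂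
  refine ⟨⟨fun h => ?_, hback⟩, ⟨?_, fun h => ?_⟩⟩
  · exact exists_moebius_of_bmean2_eq hIopen hIconn hfd hfd2 hfd3 hgd hgd2 hgd3 hf' hg' hfleft
      hgleft hp₁ hp₂ hq₁ hq₂ hcont.1 hcont.2 hpne isOpen_univ (fun _ _ => Set.mem_univ _)
      fun z _ hz => h z.1 hz.1 z.2 hz.2
  · rintro ⟨U, hU, -, hdiag, hmean⟩
    exact exists_moebius_of_bmean2_eq hIopen hIconn hfd hfd2 hfd3 hgd hgd2 hgd3 hf' hg' hfleft
      hgleft hp₁ hp₂ hq₁ hq₂ hcont.1 hcont.2 hpne hU hdiag fun z hz _ => hmean z hz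
  · exact ⟨I ×ˢ I, hIopen.prod hIopen, subset_rfl, fun x hx => ⟨hx, hx⟩,
      fun z hz => hback h z.1 hz.1 z.2 hz.2⟩
end
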